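/- arXiv:1912.07858 — 5 statements merged into one kernel-verified Lean document; each statement's English description precedes it below -/
import Mathlib

section
/- For any positive reals b and ε there exists a constant N such that the following holds for every n ≥ N and every d with ln^{1+6b+12ε} n ≤ d ≤ n. Let G be a d-regular simple graph on n vertices, let V₀ ⊆ V(G) with n₀ = |V₀| satisfying n(1 − 1/ln^{b+ε} n − 1/ln^{2b+4ε} n) ≤ n₀ ≤ n(1 − 1/ln^{b+ε} n + 1/ln^{2b+4ε} n), let G₀ = G[V₀] be the induced subgraph, and suppose every v ∈ V₀ satisfies d(1 − 1/ln^{b+ε} n − 1/ln^{2b+4ε} n) ≤ d₀(v) ≤ d(1 − 1/ln^{b+ε} n + 1/ln^{2b+4ε} n), where d₀(v) is the degree of v in G₀. Then there exist pairwise distinct reals x_v ∈ [0,1], v ∈ V₀, such that, setting L_v = {u ∈ V₀ : x_u < x_v} and R_v = {u ∈ N_{G₀}(v) : x_u ≥ 1 − x_v}, for every v ∈ V₀ with x = x_v: (3°) if x ≥ 1/ln^{2b+3ε} n then | |L_v| − x(n₀ − 1) | ≤ x(n₀ − 1)/ln^{2b+4ε} n; (4°) if x < 1/ln^{2b+3ε}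 n then |L_v| ≤ (n₀ − 1)/ln^{2b+3ε} n + (n₀ − 1)/ln^{4b+7ε} n; (5°) if x ≥ 1/ln^{2b+3ε} n then | |R_v| − x·d₀(v) | ≤ x·d₀(v)/ln^{2b+4ε} n; (6°) if x < 1/ln^{2b+3ε} n then |R_v| ≤ d₀(v)/ln^{2b+3ε} n + d₀(v)/ln^{4b+7ε} n. -/
open Finset

/-- `degIn G v S` is the number of neighbours of `v` lying in the set `S`. -/
def degIn {V : Type} [Fintype V] [DecidableEq V] (G : SimpleGraph V) [DecidableRel G.Adj]
    (v : V) (S : Finset V) : ℕ :=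
  (G.neighborFinset v ∩ S).card

/-- The fraction of the label set `α` lying in `A`. -/
noncomputable def labelDensity {α : Type*} [Fintype α] (A : Finset α) : ℝ :=
  (A.card : ℝ) / Fintype.card α

/-- The number of elements of `S` whose label under `f` lies in `A`. -/
def labelCount {V α : Type*} [DecidableEq α] (S : Finset V) (A : Finset α) (f : V → α) : ℕ :=
  (S.filter fun u => f u ∈ A).card

section Chernoff

variable {V α : Type*} [Fintype V] [DecidableEq V] [Fintype α] [DecidableEq α]

/-- Two given points receive equal labels with probability at most `1 / card α`. -/
lemma card_collision_mul_le {u v : V} (huv : u ≠ v) :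
    (univ.filter fun f : V → α => f u = f v).card * Fintype.card α ≤
      Fintype.card (V → α) := by
  rw [← Finset.card_univ (α := α), ← Finset.card_product, ← Finset.card_univ (α := V → α)]
  refine Finset.card_le_card_of_injOn (fun q => Function.update q.1 u q.2) (by simp) ?_
  rintro ⟨f, k⟩ hf ⟨g, l⟩ hg h
  simp only [Finset.coe_product, Finset.coe_filter, Finset.mem_univ, true_and,
    Finset.coe_univ, Set.mem_prod, Set.mem_ofPred_eq, Set.mem_univ, and_true] at hf hg h
  have hkl : k = l := by simpa using congrFun h u
  have hne : ∀ w, w ≠ u → f w = g w := fun w hw => by simpa [hw] using congrFun h w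
  refine Prod.ext (funext fun w => ?_) hkl
  by_cases hw : w = u
  · subst hw
    change f w = g w
    rw [hf, hg, hne v huv.symm]
  · exact hne w hw

variable [Nonempty α]

/-- Bound for the moment generating function of `labelCount S A f` under uniform labels. -/
lemma sum_exp_mul_labelCount_le (S : Finset V) (A : Finset α) (t : ℝ) :
    ∑ f : V → α, Real.exp (t * labelCount S A f) ≤
      Fintype.card (V → α) * Real.exp (labelDensity A * S.card * (Real.exp t - 1)) := by
  have hM : (0 : ℝ) < Fintype.card α := by exact_mod_cast Fintype.card_pos
  have hprod : ∀ f : V → α, Real.exp (t * labelCount S A f) =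
      ∏ u : V, if u ∈ S then (if f u ∈ A then Real.exp t else 1) else 1 := by
    intro f
    rw [Finset.prod_ite_mem, Finset.univ_inter, Finset.prod_ite, Finset.prod_const_one, mul_one,
      Finset.prod_const, mul_comm, Real.exp_nat_mul]
    rfl
  have hsum : ∀ u : V, ∑ k : α, (if u ∈ S then (if k ∈ A then Real.exp t else 1) else 1) ≤
      (Fintype.card α : ℝ) *
        (if u ∈ S then Real.exp (labelDensity A * (Real.exp t - 1)) else 1) := by
    intro u
    split_ifs with hu
    · have h1 : ∑ k : α, (if k ∈ A then Real.exp t else 1) =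
          Fintype.card α * (labelDensity A * (Real.exp t - 1) + 1) := by
        have : ∀ k : α, (if k ∈ A then Real.exp t else 1) =
            (if k ∈ A then Real.exp t - 1 else 0) + 1 := by
          intro k; split_ifs <;> ring
        simp_rw [this]
        rw [Finset.sum_add_distrib, Finset.sum_ite_mem]
        simp only [Finset.univ_inter, Finset.sum_const, nsmul_eq_mul, Finset.card_univ, mul_one,
          labelDensity]
        field_simp
      rw [h1]
      exact mul_le_mul_of_nonneg_left (Real.add_one_le_exp _) hM.le
    · simp
  calc ∑ f : V → α, Real.exp (t * labelCount S A f)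
      = ∏ u : V, ∑ k : α, (if u ∈ S then (if k ∈ A then Real.exp t else 1) else 1) := by
        rw [Fintype.prod_sum]
        exact Finset.sum_congr rfl fun f _ => hprod f
    _ ≤ ∏ u : V, ((Fintype.card α : ℝ) *
        (if u ∈ S then Real.exp (labelDensity A * (Real.exp t - 1)) else 1)) := by
        refine Finset.prod_le_prod (fun u _ => Finset.sum_nonneg fun k _ => ?_) fun u _ => hsum u
        split_ifs <;> positivity
    _ = _ := by
        rw [Finset.prod_mul_distrib, Finset.prod_ite_mem, Finset.univ_inter, Finset.prod_const,
          Finset.prod_const, ← Real.exp_nat_mul, Fintype.card_fun, Finset.card_univ]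
        push_cast
        ring_nf

lemma exp_sub_one_le_add_sq {t : ℝ} (ht : |t| ≤ 1) : Real.exp t - 1 ≤ t + t ^ 2 := by
  have := (abs_le.1 (Real.abs_exp_sub_one_sub_id_le ht)).2
  linarith

/-- Exponential weight controlling the upper tail of `labelCount`. -/
lemma sum_exp_upper_tail_le (S : Finset V) (A : Finset α) {δ Q : ℝ} (hδ : 0 < δ) (hδ1 : δ ≤ 1)
    (hQ : labelDensity A * S.card ≤ Q) :
    ∑ f : V → α, Real.exp (δ / 2 * (labelCount S A f - (1 + δ) * Q)) ≤
      Fintype.card (V → α) * Real.exp (-(Q * δ ^ 2 / 4)) := by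
  have hQ0 : 0 ≤ Q := le_trans (by unfold labelDensity; positivity) hQ
  have ht : Real.exp (δ / 2) - 1 ≤ δ / 2 + (δ / 2) ^ 2 :=
    exp_sub_one_le_add_sq (by rw [abs_of_pos (by positivity)]; linarith)
  have ht0 : 0 ≤ Real.exp (δ / 2) - 1 := by
    have := Real.add_one_le_exp (δ / 2); linarith
  have hexp : labelDensity A * S.card * (Real.exp (δ / 2) - 1) ≤
      Q * (δ / 2 + (δ / 2) ^ 2) :=
    mul_le_mul hQ ht ht0 hQ0
  calc ∑ f : V → α, Real.exp (δ / 2 * (labelCount S A f - (1 + δ) * Q))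
      = (∑ f : V → α, Real.exp (δ / 2 * labelCount S A f)) *
          Real.exp (-(δ / 2 * ((1 + δ) * Q))) := by
        rw [Finset.sum_mul]
        refine Finset.sum_congr rfl fun f _ => ?_
        rw [← Real.exp_add]; ring_nf
    _ ≤ (Fintype.card (V → α) * Real.exp (Q * (δ / 2 + (δ / 2) ^ 2))) *
          Real.exp (-(δ / 2 * ((1 + δ) * Q))) := by
        gcongr
        exact (sum_exp_mul_labelCount_le S A (δ / 2)).trans (by gcongr)
    _ = _ := by
        rw [mul_assoc, ← Real.exp_add]; ring_nf

/-- Exponential weight controlling the lower tail of `labelCount`. -/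
lemma sum_exp_lower_tail_le (S : Finset V) (A : Finset α) {δ : ℝ} (hδ : 0 < δ) (hδ1 : δ ≤ 1) :
    ∑ f : V → α,
      Real.exp (-(δ / 2) * (labelCount S A f - (1 - δ) * (labelDensity A * S.card))) ≤
      Fintype.card (V → α) * Real.exp (-(labelDensity A * S.card * δ ^ 2 / 4)) := by
  set Q : ℝ := labelDensity A * S.card with hQ
  have hQ0 : 0 ≤ Q := by rw [hQ]; unfold labelDensity; positivity
  have ht : Real.exp (-(δ / 2)) - 1 ≤ -(δ / 2) + (-(δ / 2)) ^ 2 :=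
    exp_sub_one_le_add_sq (by rw [abs_neg, abs_of_pos (by positivity)]; linarith)
  calc ∑ f : V → α, Real.exp (-(δ / 2) * (labelCount S A f - (1 - δ) * Q))
      = (∑ f : V → α, Real.exp (-(δ / 2) * labelCount S A f)) *
          Real.exp (δ / 2 * ((1 - δ) * Q)) := by
        rw [Finset.sum_mul]
        refine Finset.sum_congr rfl fun f _ => ?_
        rw [← Real.exp_add]; ring_nf
    _ ≤ (Fintype.card (V → α) * Real.exp (Q * (-(δ / 2) + (-(δ / 2)) ^ 2))) *
          Real.exp (δ / 2 * ((1 - δ) * Q)) := by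
        gcongr
        exact (sum_exp_mul_labelCount_le S A (-(δ / 2))).trans (by gcongr)
    _ = _ := by
        rw [mul_assoc, ← Real.exp_add]; ring_nf

/-- If the union bound leaves room, some injective labelling has all prescribed counts
concentrated around their means. -/
lemma exists_injective_concentrated_labeling {ι : Type*} (I : Finset ι) (S : ι → Finset V)
    (A : ι → Finset α) {δ τ K : ℝ} (hδ : 0 < δ) (hδ1 : δ ≤ 1)
    (hK : ∀ i ∈ I, K ≤ τ * (S i).card * δ ^ 2 / 4)
    (hsmall : (Fintype.card V : ℝ) ^ 2 / Fintype.card α + I.card * (2 * Real.exp (-K)) < 1) :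
    ∃ f : V → α, Function.Injective f ∧ ∀ i ∈ I,
      (labelCount (S i) (A i) f : ℝ) ≤ (1 + δ) * (max (labelDensity (A i)) τ * (S i).card) ∧
      (τ ≤ labelDensity (A i) →
        (1 - δ) * (labelDensity (A i) * (S i).card) ≤ labelCount (S i) (A i) f) := by
  have hM : (0 : ℝ) < Fintype.card α := by exact_mod_cast Fintype.card_pos
  have hC : (0 : ℝ) < Fintype.card (V → α) := by exact_mod_cast Fintype.card_pos
  set P : Finset (V × V) := univ.filter fun q => q.1 ≠ q.2 with hP
  have hPcard : (P.card : ℝ) ≤ (Fintype.card V : ℝ) ^ 2 := by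
    have : P.card ≤ Fintype.card (V × V) := Finset.card_le_univ P
    rw [Fintype.card_prod] at this
    rw [sq]; exact_mod_cast this
  let coll : (V → α) → V × V → ℝ := fun f q => if f q.1 = f q.2 then 1 else 0
  let up : (V → α) → ι → ℝ := fun f i => Real.exp (δ / 2 * (labelCount (S i) (A i) f -
    (1 + δ) * (max (labelDensity (A i)) τ * (S i).card)))
  let low : (V → α) → ι → ℝ := fun f i => if τ ≤ labelDensity (A i) then
    Real.exp (-(δ / 2) * (labelCount (S i) (A i) f -
      (1 - δ) * (labelDensity (A i) * (S i).card))) else 0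
  have hcoll0 : ∀ f q, 0 ≤ coll f q := fun f q => by dsimp only [coll]; split_ifs <;> norm_num
  have hup0 : ∀ f i, 0 ≤ up f i := fun f i => (Real.exp_pos _).le
  have hlow0 : ∀ f i, 0 ≤ low f i := fun f i => by
    dsimp only [low]; split_ifs <;> positivity
  have hcoll : ∀ q ∈ P, ∑ f, coll f q ≤ Fintype.card (V → α) / Fintype.card α := by
    intro q hq
    rw [le_div_iff₀ hM]
    simp only [coll, Finset.sum_boole]
    exact_mod_cast card_collision_mul_le (α := α) (Finset.mem_filter.1 hq).2
  have hup : ∀ i ∈ I, ∑ f, up f i ≤ Fintype.card (V → α) * Real.exp (-K) := by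
    intro i hi
    refine (sum_exp_upper_tail_le (S i) (A i) hδ hδ1 (by gcongr; exact le_max_left _ _)).trans ?_
    gcongr
    refine (hK i hi).trans ?_
    gcongr
    exact le_max_right _ _
  have hlow : ∀ i ∈ I, ∑ f, low f i ≤ Fintype.card (V → α) * Real.exp (-K) := by
    intro i hi
    by_cases hτ : τ ≤ labelDensity (A i)
    · simp only [low, if_pos hτ]
      refine (sum_exp_lower_tail_le (S i) (A i) hδ hδ1).trans ?_
      gcongr
      refine (hK i hi).trans ?_
      gcongr
    · simp only [low, if_neg hτ, Finset.sum_const_zero]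
      positivity
  have htotal : ∑ f : V → α, (∑ q ∈ P, coll f q + ∑ i ∈ I, (up f i + low f i)) <
      ∑ f : V → α, (1 : ℝ) := by
    rw [Finset.sum_add_distrib, Finset.sum_comm, Finset.sum_comm (t := I)]
    have h1 := Finset.sum_le_sum hcoll
    have h2 : ∑ i ∈ I, ∑ f, (up f i + low f i) ≤
        ∑ i ∈ I, (2 * (Fintype.card (V → α) * Real.exp (-K))) := by
      refine Finset.sum_le_sum fun i hi => ?_
      rw [Finset.sum_add_distrib]
      linarith [hup i hi, hlow i hi]
    simp only [Finset.sum_const, nsmul_eq_mul, Finset.card_univ, mul_one] at h1 h2 ⊢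
    have h3 : (P.card : ℝ) * (Fintype.card (V → α) / Fintype.card α) ≤
        (Fintype.card V : ℝ) ^ 2 * (Fintype.card (V → α) / Fintype.card α) := by gcongr
    have h4 := mul_lt_mul_of_pos_left hsmall hC
    calc _ ≤ _ := add_le_add (h1.trans h3) h2
      _ = _ := by ring
      _ < _ := h4
      _ = _ := mul_one _
  obtain ⟨f, -, hf⟩ := Finset.exists_lt_of_sum_lt htotal
  have hcs : 0 ≤ ∑ q ∈ P, coll f q := Finset.sum_nonneg fun q _ => hcoll0 f q
  have his : 0 ≤ ∑ i ∈ I, (up f i + low f i) :=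
    Finset.sum_nonneg fun i _ => add_nonneg (hup0 f i) (hlow0 f i)
  refine ⟨f, fun u v huv => ?_, fun i hi => ?_⟩
  · by_contra hne
    have := Finset.single_le_sum (f := coll f) (fun q _ => hcoll0 f q)
      (show (u, v) ∈ P by simpa [hP] using hne)
    simp only [coll, if_pos huv] at this
    simp only [coll] at hf
    linarith
  · have hi1 := Finset.single_le_sum (f := fun i => up f i + low f i)
      (fun i _ => add_nonneg (hup0 f i) (hlow0 f i)) hi
    have hsum : up f i + low f i < 1 := by linarith
    constructor
    · have h : up f i < 1 := by linarith [hlow0 f i]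
      rw [Real.exp_lt_one_iff] at h
      nlinarith
    · intro hτ
      have h : low f i < 1 := by linarith [hup0 f i]
      simp only [low, if_pos hτ, Real.exp_lt_one_iff] at h
      nlinarith

end Chernoff

/-- There are `j` labels whose reversal lies below `j`. -/
lemma card_map_revPerm_Iio {M : ℕ} (j : Fin M) :
    ((Finset.Iio j).map Fin.revPerm.toEmbedding).card = j := by
  rw [Finset.card_map, Fin.card_Iio]

lemma mem_map_revPerm_Iio {M : ℕ} {j k : Fin M} :
    k ∈ (Finset.Iio j).map Fin.revPerm.toEmbedding ↔ M ≤ k + j := by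
  rw [Finset.mem_map_equiv, Fin.revPerm_symm, Fin.revPerm_apply, Finset.mem_Iio, Fin.lt_def,
    Fin.val_rev]
  omega

/-- Concentration with relative error `1 / l ^ β` above the threshold `1 / l ^ α`, rewritten with
the powers of `l` in denominators. -/
lemma deviation_bounds {l α β p s X : ℝ} (hl : 0 < l)
    (hup : X ≤ (1 + 1 / l ^ β) * (max p (1 / l ^ α) * s))
    (hlow : 1 / l ^ α ≤ p → (1 - 1 / l ^ β) * (p * s) ≤ X) :
    (1 / l ^ α ≤ p → |X - p * s| ≤ p * s / l ^ β) ∧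
      (p < 1 / l ^ α → X ≤ s / l ^ α + s / l ^ (α + β)) := by
  constructor
  · intro h
    have h1 := hlow h
    rw [max_eq_left h] at hup
    rw [abs_le]
    constructor <;> ring_nf at * <;> linarith
  · intro h
    rw [max_eq_right h.le] at hup
    rw [Real.rpow_add hl]
    have h2 : s / (l ^ α * l ^ β) = s * (l ^ α)⁻¹ * (l ^ β)⁻¹ := by
      rw [div_eq_mul_inv, mul_inv, mul_assoc]
    rw [h2]
    ring_nf at *
    linarith

lemma eventually_le_log_rpow {a : ℝ} (ha : 0 < a) (C : ℝ) :
    ∀ᶠ n : ℕ in Filter.atTop, C ≤ Real.log n ^ a :=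
  ((tendsto_rpow_atTop ha).comp (Real.tendsto_log_atTop.comp
    tendsto_natCast_atTop_atTop)).eventually_ge_atTop C

theorem random_labeling_of_V0 (b ε : ℝ) (hb : 0 < b) (hε : 0 < ε) :
    ∃ N : ℕ, ∀ (V : Type) [Fintype V] [DecidableEq V] (G : SimpleGraph V)
      [DecidableRel G.Adj] (n d : ℕ) (V₀ : Finset V),
      n = Fintype.card V → G.IsRegularOfDegree d → N ≤ n →
      Real.log n ^ (1 + 6 * b + 12 * ε) ≤ (d : ℝ) → (d : ℝ) ≤ (n : ℝ) →
      -- bounds on n₀ = |V₀|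
      (n : ℝ) * (1 - 1 / Real.log n ^ (b + ε) - 1 / Real.log n ^ (2 * b + 4 * ε)) ≤
        (V₀.card : ℝ) →
      (V₀.card : ℝ) ≤
        (n : ℝ) * (1 - 1 / Real.log n ^ (b + ε) + 1 / Real.log n ^ (2 * b + 4 * ε)) →
      -- bounds on the degrees d₀(v) in the induced subgraph G₀ = G[V₀]
      (∀ v ∈ V₀,
        (d : ℝ) * (1 - 1 / Real.log n ^ (b + ε) - 1 / Real.log n ^ (2 * b + 4 * ε)) ≤
          (degIn G v V₀ : ℝ) ∧
        (degIn G v V₀ : ℝ) ≤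
          (d : ℝ) * (1 - 1 / Real.log n ^ (b + ε) + 1 / Real.log n ^ (2 * b + 4 * ε))) →
      -- conclusion: suitable pairwise distinct reals x_v ∈ [0,1] exist
      ∃ x : V → ℝ,
        Set.InjOn x ↑V₀ ∧ (∀ v ∈ V₀, x v ∈ Set.Icc (0 : ℝ) 1) ∧
        ∀ v ∈ V₀,
          -- (3°)
          (1 / Real.log n ^ (2 * b + 3 * ε) ≤ x v →
            |((V₀.filter fun u => x u < x v).card : ℝ) - x v * ((V₀.card : ℝ) - 1)| ≤
              x v * ((V₀.card : ℝ) - 1) / Real.log n ^ (2 * b + 4 * ε)) ∧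
          -- (4°)
          (x v < 1 / Real.log n ^ (2 * b + 3 * ε) →
            ((V₀.filter fun u => x u < x v).card : ℝ) ≤
              ((V₀.card : ℝ) - 1) / Real.log n ^ (2 * b + 3 * ε) +
              ((V₀.card : ℝ) - 1) / Real.log n ^ (4 * b + 7 * ε)) ∧
          -- (5°)
          (1 / Real.log n ^ (2 * b + 3 * ε) ≤ x v →
            |(((G.neighborFinset v ∩ V₀).filter fun u => 1 - x v ≤ x u).card : ℝ) -
                x v * (degIn G v V₀ : ℝ)| ≤
              x v * (degIn G v V₀ : ℝ) / Real.log n ^ (2 * b + 4 * ε)) ∧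
          -- (6°)
          (x v < 1 / Real.log n ^ (2 * b + 3 * ε) →
            (((G.neighborFinset v ∩ V₀).filter fun u => 1 - x v ≤ x u).card : ℝ) ≤
              (degIn G v V₀ : ℝ) / Real.log n ^ (2 * b + 3 * ε) +
              (degIn G v V₀ : ℝ) / Real.log n ^ (4 * b + 7 * ε)) := by
  obtain ⟨N, hN⟩ := Filter.eventually_atTop.1
    ((((eventually_le_log_rpow hε 32).and
      (eventually_le_log_rpow (show 0 < b + ε by positivity) 4)).and
      (eventually_le_log_rpow (show 0 < 2 * b + 4 * ε by positivity) 4)).and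
      (Filter.eventually_ge_atTop 100))
  refine ⟨N, ?_⟩
  intro V _ _ G _ n d V₀ hn _ hNn hd _ _ _ hdeg
  obtain ⟨⟨⟨hl1, hl2⟩, hl3⟩, hn100⟩ := hN n hNn
  have hnR : (100 : ℝ) ≤ n := by exact_mod_cast hn100
  set l := Real.log n with hldef
  have hl : 0 < l := Real.log_pos (by linarith)
  have h1 : 1 / l ^ (b + ε) ≤ 1 / 4 := one_div_le_one_div_of_le (by norm_num) hl2
  have h2 : 1 / l ^ (2 * b + 4 * ε) ≤ 1 / 4 := one_div_le_one_div_of_le (by norm_num) hl3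
  have hδ : 0 < 1 / l ^ (2 * b + 4 * ε) := by positivity
  have hsub : ∀ v ∈ V₀, degIn G v V₀ ≤ (V₀.erase v).card := by
    intro v _
    refine Finset.card_le_card fun u hu => ?_
    rw [Finset.mem_inter, SimpleGraph.mem_neighborFinset] at hu
    exact Finset.mem_erase.2 ⟨hu.1.ne', hu.2⟩
  have hhalf : ∀ v ∈ V₀, (d : ℝ) / 2 ≤ degIn G v V₀ := by
    intro v hv
    refine le_trans ?_ (hdeg v hv).1
    rw [div_eq_mul_one_div]
    exact mul_le_mul_of_nonneg_left (by linarith) d.cast_nonneg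
  have hexponent : ∀ s : ℝ, (d : ℝ) / 2 ≤ s →
      4 * l ≤ 1 / l ^ (2 * b + 3 * ε) * s * (1 / l ^ (2 * b + 4 * ε)) ^ 2 / 4 := by
    intro s hs
    have hsplit : l ^ (1 + 6 * b + 12 * ε) =
        l * l ^ ε * (l ^ (2 * b + 3 * ε) * (l ^ (2 * b + 4 * ε)) ^ 2) := by
      nth_rewrite 2 [← Real.rpow_one l]
      rw [sq, ← Real.rpow_add hl, ← Real.rpow_add hl, ← Real.rpow_add hl, ← Real.rpow_add hl]
      ring_nf
    have hD : 0 < l ^ (2 * b + 3 * ε) * (l ^ (2 * b + 4 * ε)) ^ 2 := by positivity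
    have hs' : 32 * l * (l ^ (2 * b + 3 * ε) * (l ^ (2 * b + 4 * ε)) ^ 2) ≤ 2 * s := by
      calc _ ≤ l * l ^ ε * (l ^ (2 * b + 3 * ε) * (l ^ (2 * b + 4 * ε)) ^ 2) := by
            gcongr ?_ * _
            rw [mul_comm]
            gcongr
        _ ≤ 2 * s := by rw [← hsplit]; linarith
    have heq : 1 / l ^ (2 * b + 3 * ε) * s * (1 / l ^ (2 * b + 4 * ε)) ^ 2 / 4 =
        s / 4 / (l ^ (2 * b + 3 * ε) * (l ^ (2 * b + 4 * ε)) ^ 2) := by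
      field_simp
    rw [heq, le_div_iff₀ hD]
    linarith
  set M : ℕ := 4 * n ^ 2 with hM
  have hMpos : 0 < M := by positivity
  have hMR : (0 : ℝ) < M := by exact_mod_cast hMpos
  have : Nonempty (Fin M) := ⟨⟨0, hMpos⟩⟩
  let I : Finset (Bool × V × Fin M) := univ ×ˢ V₀ ×ˢ univ
  let S : Bool × V × Fin M → Finset V := fun i =>
    bif i.1 then V₀.erase i.2.1 else G.neighborFinset i.2.1 ∩ V₀
  let A : Bool × V × Fin M → Finset (Fin M) := fun i =>
    bif i.1 then Finset.Iio i.2.2 else (Finset.Iio i.2.2).map Fin.revPerm.toEmbedding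
  have hIcard : (I.card : ℝ) ≤ 8 * (n : ℝ) ^ 3 := by
    have hV₀ : V₀.card ≤ n := hn ▸ Finset.card_le_univ V₀
    have hI : I.card = 2 * (V₀.card * M) := by simp [I]
    have : I.card ≤ 8 * n ^ 3 := by
      rw [hI]
      calc 2 * (V₀.card * M) ≤ 2 * (n * M) := by gcongr
        _ = 8 * n ^ 3 := by rw [hM]; ring
    exact_mod_cast this
  have hexp : Real.exp (-(4 * l)) = 1 / (n : ℝ) ^ 4 := by
    rw [Real.exp_neg, show (4 : ℝ) * l = (4 : ℕ) * l by norm_num, Real.exp_nat_mul, hldef,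
      Real.exp_log (by linarith), one_div]
  have hsmall : (Fintype.card V : ℝ) ^ 2 / Fintype.card (Fin M) +
      I.card * (2 * Real.exp (-(4 * l))) < 1 := by
    rw [← hn, Fintype.card_fin, hexp,
      show (M : ℝ) = 4 * (n : ℝ) ^ 2 by rw [hM]; push_cast; ring]
    have hn0 : (0 : ℝ) < n := by linarith
    calc _ ≤ (n : ℝ) ^ 2 / (4 * n ^ 2) + 8 * (n : ℝ) ^ 3 * (2 * (1 / (n : ℝ) ^ 4)) := by gcongr
      _ = 1 / 4 + 16 / n := by field_simp; ring
      _ ≤ 1 / 4 + 16 / 100 := by gcongr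
      _ < 1 := by norm_num
  obtain ⟨f, hinj, hf⟩ := exists_injective_concentrated_labeling I S A
    (τ := 1 / l ^ (2 * b + 3 * ε)) hδ (by linarith) (K := 4 * l) (by
      rintro ⟨c, v, j⟩ hi
      have hv : v ∈ V₀ := by simpa [I] using hi
      apply hexponent
      cases c
      · exact hhalf v hv
      · exact (hhalf v hv).trans (by exact_mod_cast hsub v hv)) hsmall
  refine ⟨fun v => (f v : ℝ) / M, ?_, ?_, ?_⟩
  · intro u _ v _ huv
    have : ((f u : ℕ) : ℝ) = (f v : ℕ) := (div_left_inj' hMR.ne').1 huv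
    exact hinj (Fin.ext (by exact_mod_cast this))
  · intro v _
    refine ⟨by positivity, ?_⟩
    rw [div_le_one hMR]
    exact_mod_cast (f v).isLt.le
  · intro v hv
    have hleft : (V₀.filter fun u => (f u : ℝ) / M < (f v : ℝ) / M).card =
        labelCount (V₀.erase v) (Finset.Iio (f v)) f := by
      unfold labelCount
      congr 1
      ext u
      rw [Finset.mem_filter, Finset.mem_filter, Finset.mem_erase, Finset.mem_Iio,
        div_lt_div_iff_of_pos_right hMR, Nat.cast_lt, Fin.lt_def]
      constructor
      · rintro ⟨hu, h⟩
        exact ⟨⟨by rintro rfl; exact lt_irrefl _ h, hu⟩, h⟩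
      · rintro ⟨⟨-, hu⟩, h⟩
        exact ⟨hu, h⟩
    have hright : ((G.neighborFinset v ∩ V₀).filter
        fun u => 1 - (f v : ℝ) / M ≤ (f u : ℝ) / M).card =
        labelCount (G.neighborFinset v ∩ V₀)
          ((Finset.Iio (f v)).map Fin.revPerm.toEmbedding) f := by
      unfold labelCount
      congr 1
      refine Finset.filter_congr fun u _ => ?_
      rw [mem_map_revPerm_Iio, sub_le_iff_le_add, ← add_div, one_le_div hMR]
      exact_mod_cast Iff.rfl
    have herase : ((V₀.erase v).card : ℝ) = (V₀.card : ℝ) - 1 := by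
      rw [Finset.card_erase_of_mem hv, Nat.cast_pred (Finset.card_pos.2 ⟨v, hv⟩)]
    have hpL : labelDensity (Finset.Iio (f v)) = (f v : ℝ) / M := by
      rw [labelDensity, Fin.card_Iio, Fintype.card_fin]
    have hpR : labelDensity ((Finset.Iio (f v)).map Fin.revPerm.toEmbedding) = (f v : ℝ) / M := by
      rw [labelDensity, card_map_revPerm_Iio, Fintype.card_fin]
    have hL := hf (true, v, f v) (by simp [I, hv])
    have hR := hf (false, v, f v) (by simp [I, hv])
    simp only [S, A, cond_true, cond_false, hpL, hpR, herase] at hL hR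
    have hL' := deviation_bounds hl hL.1 hL.2
    have hR' := deviation_bounds hl hR.1 hR.2
    have hadd : 2 * b + 3 * ε + (2 * b + 4 * ε) = 4 * b + 7 * ε := by ring
    rw [hadd] at hL' hR'
    rw [hleft, hright]
    exact ⟨hL'.1, hL'.2, hR'.1, hR'.2⟩
end

section
/- For any positive reals b and ε there exists a constant N such that the following holds for every n ≥ N. Let G be a d-regular simple graph on n vertices with ln^{1+6b+12ε} n ≤ d ≤ n/ln^{2b+5ε} n, let U = U₁ ∪ … ∪ U₇ ⊆ V(G) be a partition satisfying (1°) | |U_i| − (1/7)·n/ln^{b+ε} n | ≤ (1/7)·n/ln^{2b+4ε} n and (2°) | d_{U_i}(v) − (1/7)·d/ln^{b+ε} n | ≤ (1/7)·d/ln^{2b+4ε} n for all v ∈ V(G) and i ∈ {1,…,7}, and set V₀ = V(G) ∖ U, n₀ = |V₀|, G₀ = G[V₀], d₀(v) the degree of v in G₀. Let (x_v)_{v∈V₀} be pairwise distinct reals in [0,1] satisfying conditions (3°)–(6°) (with L_v = {u ∈ V₀ : x_u < x_v} and R_v = {u ∈ N_{G₀}(v) : x_u ≥ 1 − x_v}).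 Define B₀ = ⌈n/ln^{b+ε} n⌉ + 4⌈n/ln^{2b+ε} n⌉ + 2⌈n/ln^{2b+3ε} n⌉ and N' = ⌈n/ln^{2b+2ε} n⌉ − 2⌈n/ln^{3b+5ε} n⌉. Then for every v ∈ V₀: B₀ + |L_v| − N' < |R_v|·⌈n/d⌉ + Σ_{i=1}^{7} d_{U_i}(v)·(⌈n/d⌉ + i·⌈n/(d ln^b n)⌉) ≤ B₀ + |L_v|. -/
open Finset

/-- Rounding up the second factor of a product `s * y`, where `s` is close to `m`, costs at most
the error of `s` times `y` plus `s` itself. -/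
theorem abs_mul_sub_le_of_ceil_bounds {s m e y C : ℝ} (hs : |s - m| ≤ e) (hs0 : 0 ≤ s)
    (hy : 0 ≤ y) (hC : y ≤ C) (hC' : C ≤ y + 1) : |s * C - m * y| ≤ e * y + s := by
  have h := abs_le.1 hs
  have h1 : s * y ≤ s * C := mul_le_mul_of_nonneg_left hC hs0
  have h2 : s * C ≤ s * (y + 1) := mul_le_mul_of_nonneg_left hC' hs0
  have h3 : (s - m) * y ≤ e * y := mul_le_mul_of_nonneg_right h.2 hy
  have h4 : -e * y ≤ (s - m) * y := mul_le_mul_of_nonneg_right h.1 hy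
  rw [abs_le]
  constructor <;> linarith

/-- The difference of the weighted back-degree `a * C` and the rank `l` when both `a` and `l` are
concentrated around the `x`-fractions of `d₀` and `n₀ - 1`. -/
theorem abs_mul_sub_le_of_concentrated {n d c t x C l a n₀ d₀ s u : ℝ}
    (hd : 1 ≤ d) (hdn : d ≤ n * t) (ht : 0 ≤ t) (hx0 : 0 ≤ x) (hx1 : x ≤ 1)
    (hC : n / d ≤ C) (hC' : C ≤ n / d + 1) (ha : 0 ≤ a) (had : a ≤ d)
    (hn₀ : 1 ≤ n₀) (hs0 : 0 ≤ s) (hn₀u : n₀ + u = n) (hd₀s : d₀ + s = d)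
    (hu0 : 0 ≤ u) (hu : |u - n * c| ≤ n * t) (hs : |s - d * c| ≤ d * t)
    (hl : |l - x * (n₀ - 1)| ≤ x * (n₀ - 1) * t) (hax : |a - x * d₀| ≤ x * d₀ * t) :
    |a * C - l| ≤ 7 * (n * t) := by
  have hd0 : 0 < d := by linarith
  have hr : 0 ≤ n / d := div_nonneg (by linarith) hd0.le
  have hrd : d * (n / d) = n := by field_simp
  set r := n / d with hr_def
  have key := abs_le.1 (abs_mul_sub_le_of_ceil_bounds hax ha hr hC hC')
  have h1 : x * d₀ * t * r ≤ n * t := by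
    have : x * d₀ ≤ d := by nlinarith
    calc x * d₀ * t * r ≤ d * t * r := by gcongr
      _ = d * r * t := by ring
      _ = n * t := by rw [hrd]
  have h2 : x * (n₀ - 1) * t ≤ n * t := by
    have : x * (n₀ - 1) ≤ n := by nlinarith
    gcongr
  have hs' := abs_le.1 hs
  have hu' := abs_le.1 hu
  have h3 : |d₀ * r - (n₀ - 1)| ≤ 3 * (n * t) := by
    have e1 : d₀ * r = n - s * r := by rw [← hrd, ← hd₀s]; ring
    have e2 : (s - d * c) * r ≤ d * t * r := mul_le_mul_of_nonneg_right hs'.2 hr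
    have e3 : -(d * t) * r ≤ (s - d * c) * r := mul_le_mul_of_nonneg_right hs'.1 hr
    have e4 : d * t * r = n * t := by rw [← hrd]; ring
    have e5 : d * c * r = n * c := by rw [← hrd]; ring
    rw [abs_le]
    constructor <;> nlinarith
  have h4 : |x * d₀ * r - x * (n₀ - 1)| ≤ 3 * (n * t) := by
    rw [mul_assoc, ← mul_sub, abs_mul, abs_of_nonneg hx0]
    calc x * |d₀ * r - (n₀ - 1)| ≤ 1 * |d₀ * r - (n₀ - 1)| := by gcongr
      _ ≤ 3 * (n * t) := by rwa [one_mul]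
  have hl' := abs_le.1 hl
  have h4' := abs_le.1 h4
  rw [abs_le]
  constructor <;> linarith

/-- The weighted back-degree `a * C` when `a` is only bounded from above. -/
theorem mul_le_of_le_small_fraction {n d t f q C a d₀ : ℝ}
    (hd : 1 ≤ d) (hdn : d ≤ n * t) (ht : 0 ≤ t) (hf : 0 ≤ f) (hq : 0 ≤ q) (hqt : q ≤ t)
    (hC' : C ≤ n / d + 1) (ha : 0 ≤ a) (had : a ≤ d) (hd₀d : d₀ ≤ d)
    (hax : a ≤ d₀ * f + d₀ * q) : a * C ≤ n * f + 2 * (n * t) := by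
  have hd0 : 0 < d := by linarith
  have hn : 0 ≤ n := by
    by_contra h
    nlinarith
  have hrd : d * (n / d) = n := by field_simp
  have hr : 0 ≤ n / d := div_nonneg hn hd0.le
  have h1 : a ≤ d * f + d * t := hax.trans (by gcongr)
  calc a * C ≤ a * (n / d + 1) := by gcongr
    _ = a * (n / d) + a := by ring
    _ ≤ (d * f + d * t) * (n / d) + n * t := by gcongr; linarith
    _ = d * (n / d) * (f + t) + n * t := by ring
    _ = n * f + 2 * (n * t) := by rw [hrd]; ring

/-- The deterministic core: two-sided bounds for the weighted degree of one vertex, where `s` and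
`s₂` are the plain and the `1, …, 7`-weighted sums of its degrees into the seven parts. -/
theorem weighted_degree_bounds {n d c g t f h q k C D l a n₀ d₀ s s₂ u x : ℝ}
    {b₁ b₂ b₃ b₄ b₅ : ℝ}
    (hd : 1 ≤ d) (hdn : d ≤ n * t) (ht : 0 ≤ t) (hg : 0 ≤ g) (hg1 : g ≤ 1)
    (hq : 0 ≤ q) (hqt : q ≤ t) (hkt : k ≤ t)
    (htf : 100 * t ≤ f) (hfh : 100 * f ≤ h)
    (hb₁ : n * c ≤ b₁ ∧ b₁ ≤ n * c + 1) (hb₂ : n * (c * g) ≤ b₂ ∧ b₂ ≤ n * (c * g) + 1)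
    (hb₃ : n * f ≤ b₃ ∧ b₃ ≤ n * f + 1) (hb₄ : n * h ≤ b₄)
    (hb₅ : b₅ ≤ n * k + 1)
    (hC : n / d ≤ C ∧ C ≤ n / d + 1) (hD : n / d * g ≤ D ∧ D ≤ n / d * g + 1)
    (hx0 : 0 ≤ x) (hx1 : x ≤ 1) (hl0 : 0 ≤ l) (ha : 0 ≤ a) (had : a ≤ d)
    (hn₀ : 1 ≤ n₀) (hd₀ : 0 ≤ d₀) (hs0 : 0 ≤ s) (hs₂0 : 0 ≤ s₂) (hs₂s : s₂ ≤ 7 * s)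
    (hn₀u : n₀ + u = n) (hd₀s : d₀ + s = d)
    (hu0 : 0 ≤ u) (hu : |u - n * c| ≤ n * t) (hs : |s - d * c| ≤ d * t)
    (hs₂ : |s₂ - 4 * (d * c)| ≤ 4 * (d * t))
    (hlarge : f ≤ x →
      |l - x * (n₀ - 1)| ≤ x * (n₀ - 1) * t ∧ |a - x * d₀| ≤ x * d₀ * t)
    (hsmall : x < f →
      l ≤ (n₀ - 1) * f + (n₀ - 1) * q ∧ a ≤ d₀ * f + d₀ * q) :
    b₁ + 4 * b₂ + 2 * b₃ + l - (b₄ - 2 * b₅) < a * C + (s * C + s₂ * D) ∧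
      a * C + (s * C + s₂ * D) ≤ b₁ + 4 * b₂ + 2 * b₃ + l := by
  obtain ⟨hb₁l, hb₁u⟩ := hb₁
  obtain ⟨hb₂l, hb₂u⟩ := hb₂
  obtain ⟨hb₃l, hb₃u⟩ := hb₃
  have hd0 : 0 < d := by linarith
  have hn : 0 ≤ n := by linarith
  have hf : 0 ≤ f := by linarith
  have hrd : d * (n / d) = n := by field_simp
  have hr : 0 ≤ n / d := div_nonneg hn hd0.le
  have hE1 : 1 ≤ n * t := hd.trans hdn
  have htf' : 100 * (n * t) ≤ n * f := by nlinarith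
  have hfh' : 100 * (n * f) ≤ n * h := by nlinarith
  have hk' : n * k ≤ n * t := mul_le_mul_of_nonneg_left hkt hn
  obtain ⟨hSl, hSu⟩ := abs_le.1 (abs_mul_sub_le_of_ceil_bounds hs hs0 hr hC.1 hC.2)
  obtain ⟨hS₂l, hS₂u⟩ := abs_le.1
    (abs_mul_sub_le_of_ceil_bounds hs₂ hs₂0 (mul_nonneg hr hg) hD.1 hD.2)
  have e1 : d * t * (n / d) = n * t := by rw [mul_right_comm, hrd]
  have e2 : d * c * (n / d) = n * c := by rw [mul_right_comm, hrd]
  have e3 : 4 * (d * c) * (n / d * g) = 4 * (n * (c * g)) := by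
    linear_combination 4 * g * e2
  have e4 : 4 * (d * t) * (n / d * g) ≤ 4 * (n * t) := by
    have : 4 * (d * t) * (n / d * g) = 4 * (n * t) * g := by linear_combination 4 * g * e1
    rw [this]
    nlinarith
  rw [e1, e2] at hSl hSu
  rw [e3] at hS₂l hS₂u
  rcases le_or_gt f x with hfx | hfx
  · obtain ⟨h1, h2⟩ := hlarge hfx
    obtain ⟨h3, h4⟩ := abs_le.1 (abs_mul_sub_le_of_concentrated hd hdn ht hx0 hx1 hC.1 hC.2 ha had hn₀
      hs0 hn₀u hd₀s hu0 hu hs h1 h2)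
    constructor <;> linarith only [hd, hdn, hE1, htf', hfh', hk', hb₁l, hb₁u, hb₂l, hb₂u, hb₃l,
      hb₃u, hb₄, hb₅, hSl, hSu, hS₂l, hS₂u, e4, hs₂s, hd₀s, hd₀, h3, h4]
  · obtain ⟨h1, h2⟩ := hsmall hfx
    have h3 := mul_le_of_le_small_fraction hd hdn ht hf hq hqt hC.2 ha had (by linarith) h2
    have h4 : l ≤ n * f + n * t := h1.trans <|
      add_le_add (mul_le_mul_of_nonneg_right (by linarith) hf)
        (mul_le_mul (by linarith) hqt hq hn)
    have h5 : 0 ≤ a * C := mul_nonneg ha (hr.trans hC.1)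
    constructor <;> linarith only [hd, hdn, hE1, htf', hfh', hk', hb₁l, hb₁u, hb₂l, hb₂u, hb₃l,
      hb₃u, hb₄, hb₅, hSl, hSu, hS₂l, hS₂u, e4, hs₂s, hd₀s, hd₀, hl0, h3, h4, h5]

theorem ceil_mem_bounds {y : ℝ} (hy : 0 ≤ y) : y ≤ (⌈y⌉₊ : ℝ) ∧ (⌈y⌉₊ : ℝ) ≤ y + 1 :=
  ⟨Nat.le_ceil y, (Nat.ceil_lt_add_one hy).le⟩

theorem sum_card_inter_add_card_inter_compl {V ι : Type} [Fintype V] [DecidableEq V] [Fintype ι]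
    (U : ι → Finset V) (hU : ∀ i j, i ≠ j → Disjoint (U i) (U j)) (S : Finset V) :
    (S ∩ (Finset.univ.biUnion U)ᶜ).card + ∑ i, (S ∩ U i).card = S.card := by
  rw [← Finset.card_biUnion fun i _ j _ hij =>
    (hU i j hij).mono Finset.inter_subset_right Finset.inter_subset_right,
    ← Finset.inter_biUnion, ← Finset.sdiff_eq_inter_compl, Finset.card_sdiff_add_card_inter]

/-- Summing seven concentration estimates, unweighted and with weights `1, …, 7`. -/
theorem abs_sum_sub_le_and_weighted {y : Fin 7 → ℝ} {m e : ℝ}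
    (h : ∀ i, |y i - 1 / 7 * m| ≤ 1 / 7 * e) :
    |∑ i, y i - m| ≤ e ∧ |∑ i : Fin 7, ((i : ℕ) + 1 : ℝ) * y i - 4 * m| ≤ 4 * e := by
  have h' := fun i => abs_le.1 (h i)
  have h0 := h' 0
  have h1 := h' 1
  have h2 := h' 2
  have h3 := h' 3
  have h4 := h' 4
  have h5 := h' 5
  have h6 := h' 6
  simp only [Fin.sum_univ_seven, abs_le, Fin.isValue, Fin.coe_ofNat_eq_mod]
  norm_num
  refine ⟨⟨?_, ?_⟩, ?_, ?_⟩ <;> linarith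

theorem weighted_degrees_in_V0 (b ε : ℝ) (hb : 0 < b) (hε : 0 < ε) :
    ∃ N : ℕ, ∀ (V : Type) [Fintype V] [DecidableEq V] (G : SimpleGraph V)
      [DecidableRel G.Adj] (n d : ℕ) (U : Fin 7 → Finset V) (V₀ : Finset V) (x : V → ℝ),
      n = Fintype.card V → G.IsRegularOfDegree d → N ≤ n →
      Real.log n ^ (1 + 6 * b + 12 * ε) ≤ (d : ℝ) →
      (d : ℝ) ≤ (n : ℝ) / Real.log n ^ (2 * b + 5 * ε) →
      -- U = U₁ ∪ … ∪ U₇ is a partition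
      (∀ i j : Fin 7, i ≠ j → Disjoint (U i) (U j)) →
      -- (1°)
      (∀ i : Fin 7,
        |((U i).card : ℝ) - (1 / 7) * ((n : ℝ) / Real.log n ^ (b + ε))| ≤
          (1 / 7) * ((n : ℝ) / Real.log n ^ (2 * b + 4 * ε))) →
      -- (2°)
      (∀ v : V, ∀ i : Fin 7,
        |(degIn G v (U i) : ℝ) - (1 / 7) * ((d : ℝ) / Real.log n ^ (b + ε))| ≤
          (1 / 7) * ((d : ℝ) / Real.log n ^ (2 * b + 4 * ε))) →
      -- V₀ = V ∖ U
      V₀ = (Finset.univ.biUnion U)ᶜ →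
      -- pairwise distinct reals x_v ∈ [0,1]
      Set.InjOn x ↑V₀ → (∀ v ∈ V₀, x v ∈ Set.Icc (0 : ℝ) 1) →
      -- conditions (3°)–(6°)
      (∀ v ∈ V₀,
        (1 / Real.log n ^ (2 * b + 3 * ε) ≤ x v →
          |((V₀.filter fun u => x u < x v).card : ℝ) - x v * ((V₀.card : ℝ) - 1)| ≤
            x v * ((V₀.card : ℝ) - 1) / Real.log n ^ (2 * b + 4 * ε)) ∧
        (x v < 1 / Real.log n ^ (2 * b + 3 * ε) →
          ((V₀.filter fun u => x u < x v).card : ℝ) ≤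
            ((V₀.card : ℝ) - 1) / Real.log n ^ (2 * b + 3 * ε) +
            ((V₀.card : ℝ) - 1) / Real.log n ^ (4 * b + 7 * ε)) ∧
        (1 / Real.log n ^ (2 * b + 3 * ε) ≤ x v →
          |(((G.neighborFinset v ∩ V₀).filter fun u => 1 - x v ≤ x u).card : ℝ) -
              x v * (degIn G v V₀ : ℝ)| ≤
            x v * (degIn G v V₀ : ℝ) / Real.log n ^ (2 * b + 4 * ε)) ∧
        (x v < 1 / Real.log n ^ (2 * b + 3 * ε) →
          (((G.neighborFinset v ∩ V₀).filter fun u => 1 - x v ≤ x u).card : ℝ) ≤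
            (degIn G v V₀ : ℝ) / Real.log n ^ (2 * b + 3 * ε) +
            (degIn G v V₀ : ℝ) / Real.log n ^ (4 * b + 7 * ε))) →
      -- conclusion: B₀ + |L_v| - N' < σ_{ω₀}(v) ≤ B₀ + |L_v| for every v ∈ V₀
      ∀ v ∈ V₀,
        ((⌈(n : ℝ) / Real.log n ^ (b + ε)⌉₊ : ℝ) +
              4 * (⌈(n : ℝ) / Real.log n ^ (2 * b + ε)⌉₊ : ℝ) +
              2 * (⌈(n : ℝ) / Real.log n ^ (2 * b + 3 * ε)⌉₊ : ℝ)) +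
            ((V₀.filter fun u => x u < x v).card : ℝ) -
            ((⌈(n : ℝ) / Real.log n ^ (2 * b + 2 * ε)⌉₊ : ℝ) -
              2 * (⌈(n : ℝ) / Real.log n ^ (3 * b + 5 * ε)⌉₊ : ℝ)) <
          (((G.neighborFinset v ∩ V₀).filter fun u => 1 - x v ≤ x u).card : ℝ) *
              (⌈(n : ℝ) / (d : ℝ)⌉₊ : ℝ) +
            ∑ i : Fin 7, (degIn G v (U i) : ℝ) *
              ((⌈(n : ℝ) / (d : ℝ)⌉₊ : ℝ) +
                ((i : ℕ) + 1 : ℝ) * (⌈(n : ℝ) / ((d : ℝ) * Real.log n ^ b)⌉₊ : ℝ)) ∧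
        (((G.neighborFinset v ∩ V₀).filter fun u => 1 - x v ≤ x u).card : ℝ) *
              (⌈(n : ℝ) / (d : ℝ)⌉₊ : ℝ) +
            ∑ i : Fin 7, (degIn G v (U i) : ℝ) *
              ((⌈(n : ℝ) / (d : ℝ)⌉₊ : ℝ) +
                ((i : ℕ) + 1 : ℝ) * (⌈(n : ℝ) / ((d : ℝ) * Real.log n ^ b)⌉₊ : ℝ)) ≤
          ((⌈(n : ℝ) / Real.log n ^ (b + ε)⌉₊ : ℝ) +
              4 * (⌈(n : ℝ) / Real.log n ^ (2 * b + ε)⌉₊ : ℝ) +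
              2 * (⌈(n : ℝ) / Real.log n ^ (2 * b + 3 * ε)⌉₊ : ℝ)) +
            ((V₀.filter fun u => x u < x v).card : ℝ) := by
  obtain ⟨N, hN⟩ := Filter.eventually_atTop.1
    (((tendsto_rpow_atTop hε).comp
      (Real.tendsto_log_atTop.comp tendsto_natCast_atTop_atTop)).eventually_ge_atTop 100 |>.and
      ((Real.tendsto_log_atTop.comp
        (tendsto_natCast_atTop_atTop (R := ℝ))).eventually_ge_atTop 1))
  refine ⟨N, ?_⟩
  intro V _ _ G _ n d U V₀ x hn hG hNn hd1 hd2 hdisj hU hdeg hV₀ _ hx hcond v hv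
  obtain ⟨hLε, hL⟩ := hN n hNn
  simp only [Function.comp_apply] at hLε hL
  set L := Real.log n
  have hL0 : 0 < L := by linarith
  have hmono : ∀ p q : ℝ, p ≤ q → 1 / L ^ q ≤ 1 / L ^ p := fun p q hpq =>
    one_div_le_one_div_of_le (by positivity) (Real.rpow_le_rpow_of_exponent_le hL hpq)
  have hgap : ∀ p q : ℝ, q = p + ε → 100 * (1 / L ^ q) ≤ 1 / L ^ p := fun p q hpq => by
    have hp : 0 < L ^ p := by positivity
    rw [hpq, Real.rpow_add hL0, mul_one_div, div_le_div_iff₀ (by positivity) hp]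
    nlinarith
  have hpos : ∀ p : ℝ, 0 ≤ 1 / L ^ p := fun p => by positivity
  have hdR : (1 : ℝ) ≤ d := (Real.one_le_rpow hL (by positivity)).trans hd1
  have hsum_card : (V₀.card : ℝ) + ∑ i, ((U i).card : ℝ) = n := by
    have := sum_card_inter_add_card_inter_compl U hdisj Finset.univ
    simp only [Finset.univ_inter, ← hV₀, Finset.card_univ, ← hn] at this
    exact_mod_cast this
  have hsum_deg : (degIn G v V₀ : ℝ) + ∑ i, (degIn G v (U i) : ℝ) = d := by
    have := sum_card_inter_add_card_inter_compl U hdisj (G.neighborFinset v)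
    rw [← hV₀, G.card_neighborFinset_eq_degree, hG v] at this
    exact_mod_cast this
  have hn₀ : (1 : ℝ) ≤ V₀.card := by
    exact_mod_cast Finset.card_pos.2 ⟨v, hv⟩
  have hR : ((((G.neighborFinset v ∩ V₀).filter fun u => 1 - x v ≤ x u).card : ℕ) : ℝ) ≤ d := by
    have : ((G.neighborFinset v ∩ V₀).filter fun u => 1 - x v ≤ x u).card ≤ d := by
      rw [← hG v, ← G.card_neighborFinset_eq_degree]
      exact Finset.card_le_card ((Finset.filter_subset _ _).trans Finset.inter_subset_left)
    exact_mod_cast this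
  have hsplit : ∀ C D : ℝ, ∑ i : Fin 7, (degIn G v (U i) : ℝ) * (C + ((i : ℕ) + 1 : ℝ) * D) =
      (∑ i, (degIn G v (U i) : ℝ)) * C +
        (∑ i : Fin 7, ((i : ℕ) + 1 : ℝ) * (degIn G v (U i) : ℝ)) * D := fun C D => by
    rw [Finset.sum_mul, Finset.sum_mul, ← Finset.sum_add_distrib]
    exact Finset.sum_congr rfl fun i _ => by ring
  have hweight : ∑ i : Fin 7, ((i : ℕ) + 1 : ℝ) * (degIn G v (U i) : ℝ) ≤
      7 * ∑ i, (degIn G v (U i) : ℝ) := by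
    rw [Finset.mul_sum]
    gcongr with i
    have : (i : ℕ) + 1 ≤ 7 := i.isLt
    exact_mod_cast this
  have hceil : ∀ p : ℝ, (n : ℝ) * (1 / L ^ p) ≤ (⌈(n : ℝ) / L ^ p⌉₊ : ℝ) ∧
      (⌈(n : ℝ) / L ^ p⌉₊ : ℝ) ≤ n * (1 / L ^ p) + 1 := fun p => by
    rw [mul_one_div]
    exact ceil_mem_bounds (by positivity)
  have hceilD : (n : ℝ) / d * (1 / L ^ b) ≤ (⌈(n : ℝ) / (d * L ^ b)⌉₊ : ℝ) ∧
      (⌈(n : ℝ) / (d * L ^ b)⌉₊ : ℝ) ≤ n / d * (1 / L ^ b) + 1 := by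
    rw [mul_one_div, div_div]
    exact ceil_mem_bounds (by positivity)
  have hcg : 1 / L ^ (b + ε) * (1 / L ^ b) = 1 / L ^ (2 * b + ε) := by
    rw [one_div_mul_one_div, ← Real.rpow_add hL0]
    ring_nf
  have hg1 : 1 / L ^ b ≤ 1 := by
    simpa using hmono 0 b hb.le
  obtain ⟨hc3, hc4, hc5, hc6⟩ := hcond v hv
  have hUsum := (abs_sum_sub_le_and_weighted hU).1
  obtain ⟨hdegsum, hdegsum'⟩ := abs_sum_sub_le_and_weighted (hdeg v)
  rw [hsplit]
  rw [div_eq_mul_one_div (V₀.card - 1 : ℝ), div_eq_mul_one_div (V₀.card - 1 : ℝ)] at hc4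
  rw [div_eq_mul_one_div (degIn G v V₀ : ℝ), div_eq_mul_one_div (degIn G v V₀ : ℝ)] at hc6
  rw [div_eq_mul_one_div _ (L ^ (2 * b + 4 * ε))] at hc3 hc5 hUsum hdegsum hdegsum'
  rw [div_eq_mul_one_div _ (L ^ (b + ε))] at hUsum hdegsum hdegsum'
  refine weighted_degree_bounds (c := 1 / L ^ (b + ε)) (g := 1 / L ^ b)
    (t := 1 / L ^ (2 * b + 4 * ε)) (f := 1 / L ^ (2 * b + 3 * ε)) (h := 1 / L ^ (2 * b + 2 * ε))
    (q := 1 / L ^ (4 * b + 7 * ε)) (k := 1 / L ^ (3 * b + 5 * ε)) hdR ?_ (hpos _) (hpos _) hg1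
    (hpos _) (hmono _ _ (by linarith)) (hmono _ _ (by linarith)) (hgap _ _ (by ring))
    (hgap _ _ (by ring)) (hceil _) (by rw [hcg]; exact hceil _) (hceil _) (hceil _).1 (hceil _).2
    (ceil_mem_bounds (by positivity)) hceilD (hx v hv).1 (hx v hv).2 (by positivity)
    (by positivity) hR hn₀ (by positivity) (by positivity) (by positivity) hweight
    hsum_card hsum_deg (by positivity) hUsum hdegsum hdegsum'
    (fun h => ⟨hc3 h, hc5 h⟩) (fun h => ⟨hc4 h, hc6 h⟩)
  refine hd2.trans ?_
  rw [div_eq_mul_one_div]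
  exact mul_le_mul_of_nonneg_left (hmono _ _ (by linarith)) (by positivity)
end

section
/- For any positive reals b and ε there exists a constant N such that the following holds for every n ≥ N. Let G be a d-regular simple graph on n vertices with ln^{1+6b+12ε} n ≤ d ≤ n/ln^{2b+5ε} n, let U = U₁ ∪ … ∪ U₇ ⊆ V(G) be a partition satisfying (1°) and (2°), set V₀ = V(G) ∖ U, n₀ = |V₀|, G₀ = G[V₀], and let (x_v)_{v∈V₀} be pairwise distinct reals in [0,1] satisfying (3°)–(6°). Define the edge weighting ω₀ on E(G) by: ω₀(uv) = ⌈n/d⌉ if uv ∈ E(G₀) and x_u + x_v ≥ 1; ω₀(uv) = 0 if uv ∈ E(G₀) and x_u + x_v < 1; ω₀(e) = ⌈n/d⌉ + i·⌈n/(d ln^b n)⌉ for every edge e between V₀ and U_i (i = 1,…,7); and ω₀(e) = 0 for edges inside U. Let B₀ = ⌈n/ln^{b+ε} n⌉ + 4⌈n/ln^{2b+ε} n⌉ + 2⌈n/ln^{2b+3ε} n⌉, and let v₁, v₂, …, v_{n₀} be the ordering of V₀ with x_{v_i} < x_{v_j} whenever i < j. Then there exists an integer-valued function ω' on E(G) with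 ω'(e) ∈ [0, ⌈n/(d ln^{b+ε} n)⌉] for every edge e between V₀ and U and ω'(e) = 0 for all other edges, such that the weighting ω₁ = ω₀ + ω' satisfies σ_{ω₁}(v_j) = B₀ + j for every j ∈ {1, 2, …, n₀}. -/
open Finset

/-- The weighted degree of a vertex `v` under an edge weighting `ω`. -/
def weightedDeg {V : Type} (G : SimpleGraph V) [Fintype V] [DecidableRel G.Adj]
    (ω : Sym2 V → ℕ) (v : V) : ℕ :=
  ∑ u ∈ G.neighborFinset v, ω s(v, u)

/-- A total `T` not exceeding `#A * c` is the sum of values in `[0, c]` indexed by `A`. -/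
theorem exists_le_sum_eq {α : Type} [DecidableEq α] (A : Finset α) (c T : ℕ)
    (h : T ≤ #A * c) : ∃ f : α → ℕ, (∀ a, f a ≤ c) ∧ ∑ a ∈ A, f a = T := by
  induction A using Finset.induction_on generalizing T with
  | empty => exact ⟨fun _ => 0, by simp, by simpa [eq_comm] using h⟩
  | insert a A ha ih =>
    rw [card_insert_of_notMem ha, add_mul, one_mul] at h
    obtain ⟨f, hf, hs⟩ := ih (T - min T c) (by omega)
    refine ⟨Function.update f a (min T c), fun z => ?_, ?_⟩
    · by_cases hz : z = a
      · subst hz; simp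
      · simpa [hz] using hf z
    · rw [sum_insert ha, Function.update_self,
        sum_congr rfl fun z hz => Function.update_of_ne (ne_of_mem_of_not_mem hz ha) _ _, hs]
      omega

/-- Each vertex of `S` can have its weighted degree raised by a prescribed amount `T v` by adding
weights in `[0, c]` to the edges that leave `S`, provided `T v` is at most `c` times the number
of those edges. -/
theorem exists_crossing_weighting {V : Type} [Fintype V] [DecidableEq V] (G : SimpleGraph V)
    [DecidableRel G.Adj] (S : Finset V) (c : ℕ) (T : V → ℕ)
    (h : ∀ v ∈ S, T v ≤ #(G.neighborFinset v \ S) * c) :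
    ∃ ω : Sym2 V → ℕ,
      (∀ u v : V, G.Adj u v → u ∈ S → v ∉ S → ω s(u, v) ≤ c) ∧
      (∀ u v : V, G.Adj u v → (u ∈ S ↔ v ∈ S) → ω s(u, v) = 0) ∧
      ∀ v ∈ S, weightedDeg G ω v = T v := by
  have hex : ∀ v, ∃ f : V → ℕ, (∀ a, f a ≤ c) ∧
      (v ∈ S → ∑ a ∈ G.neighborFinset v \ S, f a = T v) := by
    intro v
    by_cases hv : v ∈ S
    · obtain ⟨f, hf, hs⟩ := exists_le_sum_eq _ c (T v) (h v hv)
      exact ⟨f, hf, fun _ => hs⟩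
    · exact ⟨fun _ => 0, by simp, fun h => absurd h hv⟩
  choose f hf hs using hex
  refine ⟨Sym2.lift ⟨fun u v => (if u ∈ S ∧ v ∉ S then f u v else 0) +
      (if v ∈ S ∧ u ∉ S then f v u else 0), fun u v => add_comm _ _⟩, ?_, ?_, ?_⟩
  · intro u v _ hu hv
    simpa [hu, hv] using hf u v
  · intro u v _ huv
    by_cases hu : u ∈ S <;> simp [huv]
  · intro v hv
    rw [← hs v hv, weightedDeg, ← sum_filter_add_sum_filter_not _ (· ∈ S)]
    rw [sum_eq_zero, zero_add]
    · have : (G.neighborFinset v).filter (fun u => ¬ u ∈ S) = G.neighborFinset v \ S := by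
        ext; simp
      rw [this]
      refine sum_congr rfl fun u hu => ?_
      have := (mem_sdiff.1 hu).2
      simp [this, hv]
    · intro u hu
      have := (mem_filter.1 hu).2
      simp [this, hv]

theorem sum_degIn {V : Type} [Fintype V] [DecidableEq V] (G : SimpleGraph V)
    [DecidableRel G.Adj] (U : Fin 7 → Finset V)
    (hU : ∀ i j : Fin 7, i ≠ j → Disjoint (U i) (U j)) (v : V) :
    ∑ i, degIn G v (U i) = #(G.neighborFinset v \ (univ.biUnion U)ᶜ) := by
  rw [sdiff_compl, inf_eq_inter, inter_biUnion, card_biUnion]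
  · rfl
  · exact fun i _ j _ hij => (hU i j hij).mono inter_subset_right inter_subset_right

/-- The weighted degree, under a weighting of the prescribed shape, of a vertex outside the
parts `U i`. -/
theorem weightedDeg_initial {V : Type} [Fintype V] [DecidableEq V] (G : SimpleGraph V)
    [DecidableRel G.Adj] (U : Fin 7 → Finset V)
    (hU : ∀ i j : Fin 7, i ≠ j → Disjoint (U i) (U j)) (S : Finset V)
    (hS : S = (univ.biUnion U)ᶜ) (x : V → ℝ) (ω : Sym2 V → ℕ) (M P : ℕ)
    (hin : ∀ u v : V, G.Adj u v → u ∈ S → v ∈ S →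
      ω s(u, v) = if 1 ≤ x u + x v then M else 0)
    (hout : ∀ u v : V, ∀ i : Fin 7, G.Adj u v → u ∈ S → v ∈ U i →
      ω s(u, v) = M + ((i : ℕ) + 1) * P) (v : V) (hv : v ∈ S) :
    weightedDeg G ω v =
      #((G.neighborFinset v ∩ S).filter fun u => 1 - x v ≤ x u) * M +
        (∑ i, degIn G v (U i)) * M + (∑ i : Fin 7, ((i : ℕ) + 1) * degIn G v (U i)) * P := by
  rw [weightedDeg, ← sum_inter_add_sum_sdiff (G.neighborFinset v) S, add_assoc]
  congr 1
  · rw [sum_congr rfl fun u hu => hin v u ((G.mem_neighborFinset v u).1 (mem_inter.1 hu).1) hv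
      (mem_inter.1 hu).2, ← sum_filter, sum_const, smul_eq_mul]
    congr 3
    ext u
    constructor <;> intro h <;> linarith
  · rw [hS, sdiff_compl, inf_eq_inter, inter_biUnion, sum_biUnion
      fun i _ j _ hij => (hU i j hij).mono inter_subset_right inter_subset_right,
      sum_mul, sum_mul, ← sum_add_distrib]
    refine sum_congr rfl fun i _ => ?_
    rw [sum_congr rfl fun u hu => hout v u i ((G.mem_neighborFinset v u).1 (mem_inter.1 hu).1) hv
      (mem_inter.1 hu).2, sum_const, smul_eq_mul, degIn]
    ring

theorem abs_sum_sub_le {a : Fin 7 → ℝ} {y z : ℝ}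
    (h : ∀ i, |a i - 1 / 7 * y| ≤ 1 / 7 * z) : |∑ i, a i - y| ≤ z := by
  have hsum : ∑ i, a i - y = ∑ i, (a i - 1 / 7 * y) := by simp
  calc |∑ i, a i - y| ≤ ∑ i, |a i - 1 / 7 * y| := hsum ▸ abs_sum_le_sum_abs _ _
    _ ≤ ∑ _i : Fin 7, 1 / 7 * z := sum_le_sum fun i _ => h i
    _ = z := by simp

theorem abs_weighted_sum_sub_le {a : Fin 7 → ℝ} {y z : ℝ}
    (h : ∀ i, |a i - 1 / 7 * y| ≤ 1 / 7 * z) :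
    |∑ i : Fin 7, ((i : ℕ) + 1 : ℝ) * a i - 4 * y| ≤ 4 * z := by
  have hcoef : ∑ i : Fin 7, ((i : ℕ) + 1 : ℝ) = 28 := by
    simp only [Fin.sum_univ_seven]; norm_num
  have hsum : ∑ i : Fin 7, ((i : ℕ) + 1 : ℝ) * a i - 4 * y =
      ∑ i : Fin 7, ((i : ℕ) + 1 : ℝ) * (a i - 1 / 7 * y) := by
    simp only [mul_sub, sum_sub_distrib, ← sum_mul, hcoef]; ring
  calc |∑ i : Fin 7, ((i : ℕ) + 1 : ℝ) * a i - 4 * y|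
      ≤ ∑ i : Fin 7, |((i : ℕ) + 1 : ℝ) * (a i - 1 / 7 * y)| :=
        hsum ▸ abs_sum_le_sum_abs _ _
    _ ≤ ∑ i : Fin 7, ((i : ℕ) + 1 : ℝ) * (1 / 7 * z) := by
        refine sum_le_sum fun i _ => ?_
        rw [abs_mul, abs_of_nonneg (by positivity)]
        exact mul_le_mul_of_nonneg_left (h i) (by positivity)
    _ = 4 * z := by rw [← sum_mul, hcoef]; ring

/-- If the number `R` of heavy edges, times their weight `M`, and the rank `Λ` are close, then the
deficit of the weighted degree lies between `0` and the capacity `D * c`.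
Here `s` and `t` stand for `(log n) ^ (-b)` and `(log n) ^ (-ε)`. -/
theorem deficit_bounds {n d s t M P c D E d₀ n₀ R Λ x B₁ B₂ B₃ : ℝ}
    (hs : 0 < s) (hs' : s ≤ 1 / 100) (ht : 0 < t) (ht' : t ≤ 1 / 100)
    (hd : 1 ≤ d) (hdn : d ≤ n * (s ^ 2 * t ^ 5))
    (hM : n / d ≤ M) (hM' : M ≤ n / d + 1)
    (hP : n * s / d ≤ P) (hP' : P ≤ n * s / d + 1) (hc : n * (s * t) / d ≤ c)
    (hD : |D - d * (s * t)| ≤ d * (s ^ 2 * t ^ 4))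
    (hE : |E - 4 * (d * (s * t))| ≤ 4 * (d * (s ^ 2 * t ^ 4)))
    (hd₀ : d₀ = d - D) (hn₀ : |n₀ - (n - n * (s * t))| ≤ n * (s ^ 2 * t ^ 4))
    (hd₀' : 0 ≤ d₀) (hn₀' : n₀ ≤ n) (hR : 0 ≤ R) (hΛ : 0 ≤ Λ) (hx : 0 ≤ x) (hx1 : x ≤ 1)
    (hB₁ : n * (s * t) ≤ B₁) (hB₁' : B₁ ≤ n * (s * t) + 1)
    (hB₂ : n * (s ^ 2 * t) ≤ B₂) (hB₂' : B₂ ≤ n * (s ^ 2 * t) + 1)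
    (hB₃ : n * (s ^ 2 * t ^ 3) ≤ B₃) (hB₃' : B₃ ≤ n * (s ^ 2 * t ^ 3) + 1)
    (hbig : s ^ 2 * t ^ 3 ≤ x → |Λ - x * (n₀ - 1)| ≤ x * (n₀ - 1) * (s ^ 2 * t ^ 4) ∧
      |R - x * d₀| ≤ x * d₀ * (s ^ 2 * t ^ 4))
    (hsmall : x < s ^ 2 * t ^ 3 →
      Λ ≤ (n₀ - 1) * (s ^ 2 * t ^ 3) + (n₀ - 1) * (s ^ 4 * t ^ 7) ∧
      R ≤ d₀ * (s ^ 2 * t ^ 3) + d₀ * (s ^ 4 * t ^ 7)) :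
    R * M + D * M + E * P ≤ B₁ + 4 * B₂ + 2 * B₃ + (Λ + 1) ∧
    B₁ + 4 * B₂ + 2 * B₃ + (Λ + 1) ≤ R * M + D * M + E * P + D * c := by
  have hd0 : 0 < d := by linarith
  have hst : 0 < s ^ 2 * t ^ 5 := by positivity
  have hn : 0 < n := by
    refine pos_of_mul_pos_left (hd0.trans_le hdn) hst.le
  obtain ⟨q, hq⟩ : ∃ q, q = n * (s ^ 2 * t ^ 3) := ⟨_, rfl⟩
  have hq0 : 0 < q := hq ▸ by positivity
  have hdq : d ≤ q * t ^ 2 := by rw [hq]; linarith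
  have ht2 : t ^ 2 ≤ t / 100 := by
    rw [sq]; linarith [mul_le_mul_of_nonneg_left ht' ht.le]
  have hqt : 0 < q * t := by positivity
  have hqt' : q * t ≤ q / 100 := by linarith [mul_le_mul_of_nonneg_left ht' hq0.le]
  have hqt2 : q * t ^ 2 ≤ q * t / 100 := by linarith [mul_le_mul_of_nonneg_left ht2 hq0.le]
  have hq1 : 10000 ≤ q := by linarith
  have hqt4 : n * (s ^ 2 * t ^ 4) = q * t := by rw [hq]; ring
  -- products with `M`, `P`, `c`
  have hdM : n ≤ d * M := by
    rw [div_le_iff₀ hd0] at hM; linarith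
  have hdM' : d * M ≤ n + q * t ^ 2 := by
    have := mul_le_mul_of_nonneg_left hM' hd0.le
    rw [mul_add, mul_div_cancel₀ _ hd0.ne'] at this; linarith
  have hdP : n * s ≤ d * P := by
    rw [div_le_iff₀ hd0] at hP; linarith
  have hdP' : d * P ≤ n * s + q * t ^ 2 := by
    have := mul_le_mul_of_nonneg_left hP' hd0.le
    rw [mul_add, mul_div_cancel₀ _ hd0.ne'] at this; linarith
  have hdc : n * (s * t) ≤ d * c := by
    rw [div_le_iff₀ hd0] at hc; linarith
  have hM0 : 0 ≤ M := le_trans (by positivity) hM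
  have hP0 : 0 ≤ P := le_trans (by positivity) hP
  have hc0 : 0 ≤ c := le_trans (by positivity) hc
  rw [abs_le] at hD hE hn₀
  -- small products of `s` and `t`
  have hst1 : s * t ≤ 1 / 100 := by
    linarith [mul_le_mul hs' ht' ht.le (by norm_num)]
  have hst0 : 0 < s * t := by positivity
  have hη0 : 0 < s ^ 2 * t ^ 4 := by positivity
  have hη : s ^ 2 * t ^ 4 ≤ s * t / 100 := by
    have h1 : s ^ 2 * t ^ 4 = (s * t) * (s * t * t ^ 2) := by ring
    have h2 : s * t * t ^ 2 ≤ 1 / 100 * 1 :=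
      mul_le_mul hst1 (by linarith) (by positivity) (by norm_num)
    rw [h1]; linarith [mul_le_mul_of_nonneg_left h2 hst0.le]
  obtain ⟨η, hηdef⟩ : ∃ η, η = s ^ 2 * t ^ 4 := ⟨_, rfl⟩
  obtain ⟨r, hr⟩ : ∃ r, r = s * t := ⟨_, rfl⟩
  rw [← hηdef] at hD hE hn₀ hη hη0 hqt4 hbig
  rw [← hr] at hD hE hn₀ hη hst0 hst1 hB₁ hB₁' hdc
  have hnη : n * η = q * t := hqt4
  -- `D * M`
  have hDM : n * r - q * t ≤ D * M := by
    have h1 : (r - η) * (d * M) ≤ D * M := by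
      linarith [mul_le_mul_of_nonneg_right hD.1 hM0]
    have h2 : (r - η) * n ≤ (r - η) * (d * M) :=
      mul_le_mul_of_nonneg_left hdM (by linarith)
    linarith
  have hDM' : D * M ≤ n * r + 2 * (q * t) := by
    have h1 : D * M ≤ (r + η) * (d * M) := by
      linarith [mul_le_mul_of_nonneg_right hD.2 hM0]
    have h2 : (r + η) * (d * M) ≤ (r + η) * (n + q * t ^ 2) :=
      mul_le_mul_of_nonneg_left hdM' (by linarith)
    have h3 : (r + η) * (q * t ^ 2) ≤ 1 * (q * t ^ 2) :=
      mul_le_mul_of_nonneg_right (by linarith) (by positivity)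
    linarith
  -- `E * P`
  have hnsη : n * s * η ≤ q * t := by
    rw [← hnη]
    have : s * (n * η) ≤ 1 * (n * η) :=
      mul_le_mul_of_nonneg_right (by linarith) (by positivity)
    linarith
  have hnsr : n * s * r = n * (s ^ 2 * t) := by rw [hr]; ring
  have hEP : 4 * (n * (s ^ 2 * t)) - 4 * (q * t) ≤ E * P := by
    have h1 : 4 * (r - η) * (d * P) ≤ E * P := by
      linarith [mul_le_mul_of_nonneg_right hE.1 hP0]
    have h2 : (r - η) * (n * s) ≤ (r - η) * (d * P) :=
      mul_le_mul_of_nonneg_left hdP (by linarith)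
    linarith
  have hEP' : E * P ≤ 4 * (n * (s ^ 2 * t)) + 5 * (q * t) := by
    have h1 : E * P ≤ 4 * (r + η) * (d * P) := by
      linarith [mul_le_mul_of_nonneg_right hE.2 hP0]
    have h2 : (r + η) * (d * P) ≤ (r + η) * (n * s + q * t ^ 2) :=
      mul_le_mul_of_nonneg_left hdP' (by linarith)
    have h3 : (r + η) * (q * t ^ 2) ≤ 1 * (q * t ^ 2) :=
      mul_le_mul_of_nonneg_right (by linarith) (by positivity)
    linarith
  -- the capacity
  have hDc : 10 * q + 10 ≤ D * c := by
    have h1 : (r - η) * (d * c) ≤ D * c := by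
      linarith [mul_le_mul_of_nonneg_right hD.1 hc0]
    have h2 : (r - η) * (n * r) ≤ (r - η) * (d * c) :=
      mul_le_mul_of_nonneg_left hdc (by linarith)
    have h3 : r / 2 * (n * r) ≤ (r - η) * (n * r) :=
      mul_le_mul_of_nonneg_right (by linarith) (by positivity)
    have h4 : n * r ^ 2 * t = q := by rw [hq, hr]; ring
    have h5 : 0 < n * r ^ 2 := by positivity
    have h6 : 100 * q ≤ n * r ^ 2 := by linarith [mul_le_mul_of_nonneg_left ht' h5.le]
    linarith
  -- heavy edges inside
  have hd₀M : d₀ * M ≤ n - n * r + 2 * (q * t) := by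
    rw [hd₀, sub_mul]; linarith
  have hd₀M' : n - n * r - 2 * (q * t) ≤ d₀ * M := by
    rw [hd₀, sub_mul]; linarith
  have hd₀M0 : 0 ≤ d₀ * M := by positivity
  have hqn : q ≤ n / 100 := by
    have h1 : s ^ 2 * t ^ 3 ≤ 1 / 100 := by
      have h2 : s ^ 2 * t ^ 3 = r * r * t := by rw [hr]; ring
      have h3 : r * r ≤ 1 := by
        linarith [mul_le_mul hst1 hst1 hst0.le (by norm_num)]
      rw [h2]; linarith [mul_le_mul_of_nonneg_right h3 ht.le]
    rw [hq]; linarith [mul_le_mul_of_nonneg_left h1 hn.le]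
  have hnr : 0 < n * r := by positivity
  rcases le_or_gt (s ^ 2 * t ^ 3) x with hxs | hxs
  · obtain ⟨hL, hRr⟩ := hbig hxs
    rw [abs_le] at hL hRr
    have hn₀1 : 0 ≤ n₀ - 1 := by linarith [mul_le_mul_of_nonneg_left hst1 hn.le]
    have k1 : x * (n₀ - 1) * η ≤ q * t := by
      have : x * (n₀ - 1) ≤ n := by linarith [mul_le_mul_of_nonneg_right hx1 hn₀1]
      rw [← hnη]; exact mul_le_mul_of_nonneg_right this hη0.le
    have k2 : x * d₀ * η * M ≤ 2 * (q * t) := by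
      have h1 : x * (d₀ * M) ≤ 1 * (d₀ * M) := mul_le_mul_of_nonneg_right hx1 hd₀M0
      have h2 : x * (d₀ * M) * η ≤ (2 * n) * η :=
        mul_le_mul_of_nonneg_right (by linarith) hη0.le
      linarith
    have k3 : R * M ≤ x * (d₀ * M) + 2 * (q * t) := by
      linarith [mul_le_mul_of_nonneg_right hRr.2 hM0]
    have k4 : x * (d₀ * M) - 2 * (q * t) ≤ R * M := by
      linarith [mul_le_mul_of_nonneg_right hRr.1 hM0]
    have k5 : x * (d₀ * M - n₀) ≤ 3 * (q * t) := by
      have h1 : x * (d₀ * M - n₀) ≤ x * (3 * (q * t)) :=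
        mul_le_mul_of_nonneg_left (by linarith) hx
      linarith [mul_le_mul_of_nonneg_right hx1 hqt.le]
    have k6 : x * (n₀ - d₀ * M) ≤ 3 * (q * t) := by
      have h1 : x * (n₀ - d₀ * M) ≤ x * (3 * (q * t)) :=
        mul_le_mul_of_nonneg_left (by linarith) hx
      linarith [mul_le_mul_of_nonneg_right hx1 hqt.le]
    constructor <;> linarith
  · obtain ⟨hL, hRr⟩ := hsmall hxs
    have h47 : s ^ 4 * t ^ 7 = (s ^ 2 * t ^ 3) * η := by rw [hηdef]; ring
    have hη1 : η ≤ 1 / 100 := by linarith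
    have k0 : 0 < s ^ 2 * t ^ 3 := by positivity
    have hp : s ^ 2 * t ^ 3 + s ^ 4 * t ^ 7 ≤ 101 / 100 * (s ^ 2 * t ^ 3) := by
      rw [h47]; linarith [mul_le_mul_of_nonneg_left hη1 k0.le]
    have hp0 : 0 ≤ s ^ 2 * t ^ 3 + s ^ 4 * t ^ 7 := by positivity
    have k1 : Λ ≤ 2 * q := by
      have : (n₀ - 1) * (s ^ 2 * t ^ 3 + s ^ 4 * t ^ 7) ≤
          n * (s ^ 2 * t ^ 3 + s ^ 4 * t ^ 7) :=
        mul_le_mul_of_nonneg_right (by linarith) hp0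
      linarith [mul_le_mul_of_nonneg_left hp hn.le]
    have k2 : R * M ≤ 3 / 2 * q := by
      have h1 : R * M ≤ d₀ * M * (s ^ 2 * t ^ 3 + s ^ 4 * t ^ 7) := by
        linarith [mul_le_mul_of_nonneg_right hRr hM0]
      have h2 : d₀ * M * (s ^ 2 * t ^ 3 + s ^ 4 * t ^ 7) ≤
          (11 / 10 * n) * (101 / 100 * (s ^ 2 * t ^ 3)) :=
        mul_le_mul (by linarith) hp hp0 (by positivity)
      linarith
    have k3 : 0 ≤ R * M := by positivity
    constructor <;> linarith

theorem eventually_log_rpow_neg_le {b : ℝ} (hb : 0 < b) {δ : ℝ} (hδ : 0 < δ) :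
    ∀ᶠ n : ℕ in Filter.atTop, Real.log n ^ (-b) ≤ δ :=
  ((tendsto_rpow_neg_atTop hb).comp
    (Real.tendsto_log_atTop.comp tendsto_natCast_atTop_atTop)).eventually (ge_mem_nhds hδ)

/-- Here the conclusion `σ_{ω₁}(v_j) = B₀ + j` for the increasing ordering
`v₁, …, v_{n₀}` of `V₀` by the (pairwise distinct) values `x_v` is expressed
equivalently as `σ_{ω₁}(v) = B₀ + |L_v| + 1` for every `v ∈ V₀`, since the
position of `v` in that ordering is exactly `|L_v| + 1`. -/
theorem exists_omega_prime (b ε : ℝ) (hb : 0 < b) (hε : 0 < ε) :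
    ∃ N : ℕ, ∀ (V : Type) [Fintype V] [DecidableEq V] (G : SimpleGraph V)
      [DecidableRel G.Adj] (n d : ℕ) (U : Fin 7 → Finset V) (V₀ : Finset V)
      (x : V → ℝ) (ω₀ : Sym2 V → ℕ),
      n = Fintype.card V → G.IsRegularOfDegree d → N ≤ n →
      Real.log n ^ (1 + 6 * b + 12 * ε) ≤ (d : ℝ) →
      (d : ℝ) ≤ (n : ℝ) / Real.log n ^ (2 * b + 5 * ε) →
      -- U = U₁ ∪ … ∪ U₇ is a partition
      (∀ i j : Fin 7, i ≠ j → Disjoint (U i) (U j)) →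
      -- (1°)
      (∀ i : Fin 7,
        |((U i).card : ℝ) - (1 / 7) * ((n : ℝ) / Real.log n ^ (b + ε))| ≤
          (1 / 7) * ((n : ℝ) / Real.log n ^ (2 * b + 4 * ε))) →
      -- (2°)
      (∀ v : V, ∀ i : Fin 7,
        |(degIn G v (U i) : ℝ) - (1 / 7) * ((d : ℝ) / Real.log n ^ (b + ε))| ≤
          (1 / 7) * ((d : ℝ) / Real.log n ^ (2 * b + 4 * ε))) →
      -- V₀ = V ∖ U
      V₀ = (Finset.univ.biUnion U)ᶜ →
      -- pairwise distinct reals x_v ∈ [0,1]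
      Set.InjOn x ↑V₀ → (∀ v ∈ V₀, x v ∈ Set.Icc (0 : ℝ) 1) →
      -- conditions (3°)–(6°)
      (∀ v ∈ V₀,
        (1 / Real.log n ^ (2 * b + 3 * ε) ≤ x v →
          |((V₀.filter fun u => x u < x v).card : ℝ) - x v * ((V₀.card : ℝ) - 1)| ≤
            x v * ((V₀.card : ℝ) - 1) / Real.log n ^ (2 * b + 4 * ε)) ∧
        (x v < 1 / Real.log n ^ (2 * b + 3 * ε) →
          ((V₀.filter fun u => x u < x v).card : ℝ) ≤
            ((V₀.card : ℝ) - 1) / Real.log n ^ (2 * b + 3 * ε) +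
            ((V₀.card : ℝ) - 1) / Real.log n ^ (4 * b + 7 * ε)) ∧
        (1 / Real.log n ^ (2 * b + 3 * ε) ≤ x v →
          |(((G.neighborFinset v ∩ V₀).filter fun u => 1 - x v ≤ x u).card : ℝ) -
              x v * (degIn G v V₀ : ℝ)| ≤
            x v * (degIn G v V₀ : ℝ) / Real.log n ^ (2 * b + 4 * ε)) ∧
        (x v < 1 / Real.log n ^ (2 * b + 3 * ε) →
          (((G.neighborFinset v ∩ V₀).filter fun u => 1 - x v ≤ x u).card : ℝ) ≤
            (degIn G v V₀ : ℝ) / Real.log n ^ (2 * b + 3 * ε) +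
            (degIn G v V₀ : ℝ) / Real.log n ^ (4 * b + 7 * ε))) →
      -- the initial weighting ω₀
      (∀ u v : V, G.Adj u v → u ∈ V₀ → v ∈ V₀ →
        ω₀ s(u, v) = if 1 ≤ x u + x v then ⌈(n : ℝ) / (d : ℝ)⌉₊ else 0) →
      (∀ u v : V, ∀ i : Fin 7, G.Adj u v → u ∈ V₀ → v ∈ U i →
        ω₀ s(u, v) =
          ⌈(n : ℝ) / (d : ℝ)⌉₊ +
            ((i : ℕ) + 1) * ⌈(n : ℝ) / ((d : ℝ) * Real.log n ^ b)⌉₊) →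
      (∀ u v : V, G.Adj u v → u ∉ V₀ → v ∉ V₀ → ω₀ s(u, v) = 0) →
      -- conclusion: a suitable correction ω' exists
      ∃ ω' : Sym2 V → ℕ,
        (∀ u v : V, G.Adj u v → u ∈ V₀ → v ∉ V₀ →
          ω' s(u, v) ≤ ⌈(n : ℝ) / ((d : ℝ) * Real.log n ^ (b + ε))⌉₊) ∧
        (∀ u v : V, G.Adj u v → (u ∈ V₀ ↔ v ∈ V₀) → ω' s(u, v) = 0) ∧
        ∀ v ∈ V₀,
          weightedDeg G (fun e => ω₀ e + ω' e) v =
            (⌈(n : ℝ) / Real.log n ^ (b + ε)⌉₊ +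
              4 * ⌈(n : ℝ) / Real.log n ^ (2 * b + ε)⌉₊ +
              2 * ⌈(n : ℝ) / Real.log n ^ (2 * b + 3 * ε)⌉₊) +
            ((V₀.filter fun u => x u < x v).card + 1) := by
  obtain ⟨N, hN⟩ := Filter.eventually_atTop.1
    ((eventually_log_rpow_neg_le hb (δ := 1 / 100) (by norm_num)).and
      ((eventually_log_rpow_neg_le hε (δ := 1 / 100) (by norm_num)).and
        (Filter.eventually_gt_atTop 1)))
  refine ⟨N, ?_⟩
  intro V _ _ G _ n d U V₀ x ω₀ hnV hreg hNn hdl hdu hdisj hU hdegU hV₀ _ hx hcond hin hout _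
  obtain ⟨hs', ht', hn1⟩ := hN n hNn
  have hlog : 0 < Real.log n := Real.log_pos (by exact_mod_cast hn1)
  obtain ⟨s, hsdef⟩ : ∃ s, s = Real.log n ^ (-b) := ⟨_, rfl⟩
  obtain ⟨t, htdef⟩ : ∃ t, t = Real.log n ^ (-ε) := ⟨_, rfl⟩
  rw [← hsdef] at hs'
  rw [← htdef] at ht'
  have hs : 0 < s := hsdef ▸ Real.rpow_pos_of_pos hlog _
  have ht : 0 < t := htdef ▸ Real.rpow_pos_of_pos hlog _
  have hpow : ∀ (e : ℝ) (i j : ℕ), e = i * b + j * ε →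
      Real.log n ^ e = (s ^ i * t ^ j)⁻¹ := by
    intro e i j he
    rw [hsdef, htdef, ← Real.rpow_mul_natCast hlog.le, ← Real.rpow_mul_natCast hlog.le,
      ← Real.rpow_add hlog, ← Real.rpow_neg hlog.le, he]
    congr 1
    ring
  have hd1 : (1 : ℝ) ≤ d := by
    have : (0 : ℝ) < d := (Real.rpow_pos_of_pos hlog _).trans_le hdl
    exact_mod_cast this
  rw [hpow b 1 0 (by push_cast; ring)] at hout
  simp only [hpow (b + ε) 1 1 (by push_cast; ring), hpow (2 * b + ε) 2 1 (by push_cast; ring),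
    hpow (2 * b + 3 * ε) 2 3 (by push_cast; ring),
    hpow (2 * b + 4 * ε) 2 4 (by push_cast; ring),
    hpow (2 * b + 5 * ε) 2 5 (by push_cast; ring),
    hpow (4 * b + 7 * ε) 4 7 (by push_cast; ring),
    div_inv_eq_mul, pow_one, pow_zero, mul_one, one_mul] at hdu hU hdegU hcond hout ⊢
  set M := ⌈(n : ℝ) / d⌉₊ with hM
  set P := ⌈(n : ℝ) / (d * s⁻¹)⌉₊ with hP
  set c := ⌈(n : ℝ) / (d * (s * t)⁻¹)⌉₊ with hc
  have hsum : (∑ i, (U i).card) + V₀.card = n := by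
    rw [hV₀, card_compl, card_biUnion fun i _ j _ hij => hdisj i j hij, hnV]
    have := card_le_univ (univ.biUnion U)
    rw [card_biUnion fun i _ j _ hij => hdisj i j hij] at this
    omega
  have key : ∀ v ∈ V₀,
      weightedDeg G ω₀ v ≤ ⌈(n : ℝ) * (s * t)⌉₊ + 4 * ⌈(n : ℝ) * (s ^ 2 * t)⌉₊ +
        2 * ⌈(n : ℝ) * (s ^ 2 * t ^ 3)⌉₊ + (#{u ∈ V₀ | x u < x v} + 1) ∧
      ⌈(n : ℝ) * (s * t)⌉₊ + 4 * ⌈(n : ℝ) * (s ^ 2 * t)⌉₊ +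
        2 * ⌈(n : ℝ) * (s ^ 2 * t ^ 3)⌉₊ + (#{u ∈ V₀ | x u < x v} + 1) ≤
        weightedDeg G ω₀ v + #(G.neighborFinset v \ V₀) * c := by
    intro v hv
    rw [weightedDeg_initial G U hdisj V₀ hV₀ x ω₀ M P hin hout v hv]
    have hDsum := sum_degIn G U hdisj v
    rw [← hV₀] at hDsum
    have hdeg : degIn G v V₀ + ∑ i, degIn G v (U i) = d := by
      rw [hDsum, degIn, card_inter_add_card_sdiff, G.card_neighborFinset_eq_degree, hreg v]
    rw [← hDsum]
    obtain ⟨h3, h4, h5, h6⟩ := hcond v hv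
    have hbound : ∀ y : ℝ, 0 ≤ y → y ≤ ⌈y⌉₊ ∧ (⌈y⌉₊ : ℝ) ≤ y + 1 := fun y hy =>
      ⟨Nat.le_ceil y, (Nat.ceil_lt_add_one hy).le⟩
    have eP : (n : ℝ) / (d * s⁻¹) = n * s / d := by field_simp
    have ec : (n : ℝ) / (d * (s * t)⁻¹) = n * (s * t) / d := by field_simp
    have bM := hbound ((n : ℝ) / d) (by positivity)
    have bP := hbound ((n : ℝ) / (d * s⁻¹)) (by positivity)
    have bc := hbound ((n : ℝ) / (d * (s * t)⁻¹)) (by positivity)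
    have b1 := hbound (n * (s * t)) (by positivity)
    have b2 := hbound (n * (s ^ 2 * t)) (by positivity)
    have b3 := hbound (n * (s ^ 2 * t ^ 3)) (by positivity)
    rw [← hM] at bM
    rw [← hP, eP] at bP
    rw [← hc, ec] at bc
    have := deficit_bounds (D := ((∑ i, degIn G v (U i) : ℕ) : ℝ))
      (E := ((∑ i : Fin 7, ((i : ℕ) + 1) * degIn G v (U i) : ℕ) : ℝ))
      (d₀ := degIn G v V₀) (n₀ := V₀.card)
      (R := #{u ∈ G.neighborFinset v ∩ V₀ | 1 - x v ≤ x u}) (Λ := #{u ∈ V₀ | x u < x v})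
      (x := x v)
      hs hs' ht ht' hd1 hdu bM.1 bM.2 bP.1 bP.2 bc.1 ?_ ?_ ?_ ?_ (by positivity) ?_
      (by positivity) (by positivity) (hx v hv).1 (hx v hv).2 b1.1 b1.2 b2.1 b2.2 b3.1 b3.2
      (fun h => ⟨?_, ?_⟩) (fun h => ⟨?_, ?_⟩)
    · exact_mod_cast this
    · push_cast
      exact abs_sum_sub_le (hdegU v)
    · push_cast
      exact abs_weighted_sum_sub_le (hdegU v)
    · rw [← hdeg]; push_cast; ring
    · have hsum' : (∑ i, ((U i).card : ℝ)) + V₀.card = n := by exact_mod_cast hsum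
      have h := abs_sum_sub_le hU
      rw [abs_le] at h ⊢
      constructor <;> linarith
    · exact_mod_cast (by omega : V₀.card ≤ n)
    · simpa using h3 (by simpa using h)
    · simpa using h5 (by simpa using h)
    · simpa using h4 (by simpa using h)
    · simpa using h6 (by simpa using h)
  obtain ⟨ω', h1, h2, h3⟩ := exists_crossing_weighting G V₀ c
    (fun v => ⌈(n : ℝ) * (s * t)⌉₊ + 4 * ⌈(n : ℝ) * (s ^ 2 * t)⌉₊ +
        2 * ⌈(n : ℝ) * (s ^ 2 * t ^ 3)⌉₊ + (#{u ∈ V₀ | x u < x v} + 1) - weightedDeg G ω₀ v)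
    (fun v hv => Nat.sub_le_iff_le_add'.2 (key v hv).2)
  refine ⟨ω', h1, h2, fun v hv => ?_⟩
  have hadd : weightedDeg G (fun e => ω₀ e + ω' e) v =
      weightedDeg G ω₀ v + weightedDeg G ω' v := sum_add_distrib
  rw [hadd, h3 v hv]
  exact Nat.add_sub_cancel' (key v hv).1
end

section
/- For any positive reals b and ε there exists a constant N such that the following holds for every n ≥ N. Let G be a d-regular simple graph on n vertices with ln^{1+6b+12ε} n ≤ d ≤ n/ln^{2b+5ε} n, let U ⊆ V(G) satisfy | |U| − n/ln^{b+ε} n | ≤ n/ln^{2b+4ε} n and | d_U(v) − d/ln^{b+ε} n | ≤ d/ln^{2b+4ε} n for all v ∈ V(G), and set V₀ = V(G) ∖ U, n₀ = |V₀|, B₀ = ⌈n/ln^{b+ε} n⌉ + 4⌈n/ln^{2b+ε} n⌉ + 2⌈n/ln^{2b+3ε} n⌉. Then for every nonnegative edge weighting ω of G that assigns weight at least ⌈n/d⌉ + ⌈n/(d ln^b n)⌉ to every edge joining V₀ and U, every vertex u ∈ U satisfies σ_ω(u) > B₀ + n₀; in particular B₀ + n₀ < n + 5n/ln^{2b+ε}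 n < d(1 − 1/ln^{b+ε} n − 1/ln^{2b+4ε} n)·(⌈n/d⌉ + ⌈n/(d ln^b n)⌉). -/
open Finset

/-- If every edge between the complement of `U` and `U` has weight at least `w`, then a vertex
of `U` has weighted degree at least `w` times the number of its neighbours outside `U`. -/
lemma degree_sub_degIn_mul_le_weightedDeg {V : Type} [Fintype V] [DecidableEq V]
    (G : SimpleGraph V) [DecidableRel G.Adj] {d w : ℕ} {U : Finset V}
    (hG : G.IsRegularOfDegree d) (ω : Sym2 V → ℕ)
    (hω : ∀ u v : V, G.Adj u v → u ∉ U → v ∈ U → w ≤ ω s(u, v)) {u : V} (hu : u ∈ U) :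
    ((d : ℝ) - degIn G u U) * w ≤ weightedDeg G ω u := by
  have hcard : (G.neighborFinset u \ U).card + degIn G u U = d := by
    rw [degIn, card_sdiff_add_card_inter, G.card_neighborFinset_eq_degree, hG u]
  have hsum : (G.neighborFinset u \ U).card * w ≤ weightedDeg G ω u := by
    calc (G.neighborFinset u \ U).card * w
        ≤ ∑ v ∈ G.neighborFinset u \ U, ω s(u, v) := by
          rw [← smul_eq_mul]
          refine card_nsmul_le_sum _ _ _ fun v hv => ?_
          rw [mem_sdiff, SimpleGraph.mem_neighborFinset] at hv
          rw [Sym2.eq_swap]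
          exact hω v u hv.1.symm hv.2 hu
      _ ≤ weightedDeg G ω u := sum_le_sum_of_subset sdiff_subset
  have hcast : (d : ℝ) - degIn G u U = (G.neighborFinset u \ U).card := by
    rw [← hcard]; push_cast; ring
  rw [hcast]
  exact_mod_cast hsum

lemma eventually_log_natCast_large {ε : ℝ} (hε : 0 < ε) :
    ∃ N : ℕ, ∀ n : ℕ, N ≤ n → 1 ≤ Real.log n ∧ 10 ≤ Real.log n ^ ε := by
  have hlog : Filter.Tendsto (fun n : ℕ => Real.log n) Filter.atTop Filter.atTop :=
    Real.tendsto_log_atTop.comp tendsto_natCast_atTop_atTop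
  exact Filter.eventually_atTop.1 ((hlog.eventually_ge_atTop 1).and
    (((tendsto_rpow_atTop hε).comp hlog).eventually_ge_atTop 10))

/-- The total of the rounded target degrees in terms of `X = ln^b n` and `E = ln^ε n`. -/
lemma ceil_sum_add_lt {n m X E : ℝ} (hX : 1 ≤ X) (hE : 10 ≤ E)
    (hn : X ^ 2 * E ^ 5 ≤ n) (hm : m ≤ n - n / (X * E) + n / (X ^ 2 * E ^ 4)) :
    (⌈n / (X * E)⌉₊ : ℝ) + 4 * (⌈n / (X ^ 2 * E)⌉₊ : ℝ) + 2 * (⌈n / (X ^ 2 * E ^ 3)⌉₊ : ℝ) + m <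
      n + 5 * n / (X ^ 2 * E) := by
  have hX0 : 0 < X := by linarith
  have hE0 : 0 < E := by linarith
  have hn0 : 0 ≤ n := le_trans (by positivity) hn
  have h₁ := Nat.ceil_lt_add_one (show 0 ≤ n / (X * E) by positivity)
  have h₂ := Nat.ceil_lt_add_one (show 0 ≤ n / (X ^ 2 * E) by positivity)
  have h₃ := Nat.ceil_lt_add_one (show 0 ≤ n / (X ^ 2 * E ^ 3) by positivity)
  set t := n / (X ^ 2 * E ^ 4) with ht
  have hEt : E ≤ t := by
    rw [ht, le_div_iff₀ (by positivity)]
    linarith [hn, show E * (X ^ 2 * E ^ 4) = X ^ 2 * E ^ 5 by ring]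
  have e₃ : n / (X ^ 2 * E ^ 3) = t * E := by rw [ht]; field_simp
  have e₂ : n / (X ^ 2 * E) = t * E ^ 3 := by rw [ht]; field_simp
  have e₅ : 5 * n / (X ^ 2 * E) = 5 * (t * E ^ 3) := by rw [← e₂]; ring
  rw [e₅]
  rw [e₂] at h₂ ⊢
  rw [e₃] at h₃ ⊢
  have k₁ : 10 * t ≤ t * E := by nlinarith
  have k₂ : 100 * (t * E) ≤ t * E ^ 3 := by
    have : 100 ≤ E ^ 2 := by nlinarith
    nlinarith [show 0 ≤ t * E by positivity]
  linarith

lemma one_sub_inv_bounds {X E : ℝ} (hX : 1 ≤ X) (hE : 10 ≤ E) :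
    0 ≤ 1 - 1 / (X * E) - 1 / (X ^ 2 * E ^ 4) ∧
    1 + 5 / (X ^ 2 * E) <
      (1 - 1 / (X * E) - 1 / (X ^ 2 * E ^ 4)) * (1 + 1 / X) := by
  obtain ⟨p, hp⟩ : ∃ p, p = 1 / X := ⟨_, rfl⟩
  obtain ⟨q, hq⟩ : ∃ q, q = 1 / E := ⟨_, rfl⟩
  have hp0 : 0 < p := by rw [hp]; positivity
  have hq0 : 0 < q := by rw [hq]; positivity
  have hp1 : p ≤ 1 := by rw [hp, div_le_one (by linarith)]; exact hX
  have hq1 : q ≤ 1 / 10 := by rw [hq]; exact one_div_le_one_div_of_le (by norm_num) hE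
  rw [show 1 / (X * E) = p * q by rw [hp, hq]; field_simp,
    show 1 / (X ^ 2 * E ^ 4) = p ^ 2 * q ^ 4 by rw [hp, hq]; field_simp,
    show 5 / (X ^ 2 * E) = 5 * (p ^ 2 * q) by rw [hp, hq]; field_simp, ← hp]
  have hpq : p * q ≤ 1 / 10 := by nlinarith
  have hq4 : q ^ 4 ≤ 1 / 1000 := by
    calc q ^ 4 ≤ (1 / 10) ^ 4 := by gcongr
      _ ≤ 1 / 1000 := by norm_num
  have hpq4 : p * q ^ 4 ≤ 1 / 1000 := by nlinarith [show 0 ≤ q ^ 4 by positivity]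
  have hppq4 : p ^ 2 * q ^ 4 ≤ 1 / 1000 := by nlinarith [show 0 ≤ p * q ^ 4 by positivity]
  refine ⟨by linarith, ?_⟩
  have hs : 0 < 1 - q - 6 * (p * q) - p * q ^ 4 - p ^ 2 * q ^ 4 := by linarith
  nlinarith [mul_pos hp0 hs]

/-- The weight threshold, times a lower bound for the number of neighbours outside `U`. -/
lemma add_lt_mul_ceil_add_ceil {n d X E : ℝ} (hX : 1 ≤ X) (hE : 10 ≤ E) (hn : 0 < n)
    (hd : 0 < d) :
    n + 5 * n / (X ^ 2 * E) < d * (1 - 1 / (X * E) - 1 / (X ^ 2 * E ^ 4)) *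
      ((⌈n / d⌉₊ : ℝ) + (⌈n / (d * X)⌉₊ : ℝ)) := by
  obtain ⟨hc, hlt⟩ := one_sub_inv_bounds hX hE
  have hX0 : 0 < X := by linarith
  calc n + 5 * n / (X ^ 2 * E) = n * (1 + 5 / (X ^ 2 * E)) := by ring
    _ < n * ((1 - 1 / (X * E) - 1 / (X ^ 2 * E ^ 4)) * (1 + 1 / X)) := by gcongr
    _ = d * (1 - 1 / (X * E) - 1 / (X ^ 2 * E ^ 4)) * (n / d + n / (d * X)) := by
      have : n * (1 + 1 / X) = d * (n / d + n / (d * X)) := by field_simp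
      linear_combination (1 - 1 / (X * E) - 1 / (X ^ 2 * E ^ 4)) * this
    _ ≤ _ := by
      gcongr
      · exact Nat.le_ceil _
      · exact Nat.le_ceil _

theorem weighted_degrees_in_U_large (b ε : ℝ) (hb : 0 < b) (hε : 0 < ε) :
    ∃ N : ℕ, ∀ (V : Type) [Fintype V] [DecidableEq V] (G : SimpleGraph V)
      [DecidableRel G.Adj] (n d : ℕ) (U : Finset V),
      n = Fintype.card V → G.IsRegularOfDegree d → N ≤ n →
      Real.log n ^ (1 + 6 * b + 12 * ε) ≤ (d : ℝ) →
      (d : ℝ) ≤ (n : ℝ) / Real.log n ^ (2 * b + 5 * ε) →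
      |((U.card : ℝ) - (n : ℝ) / Real.log n ^ (b + ε))| ≤
        (n : ℝ) / Real.log n ^ (2 * b + 4 * ε) →
      (∀ v : V,
        |(degIn G v U : ℝ) - (d : ℝ) / Real.log n ^ (b + ε)| ≤
          (d : ℝ) / Real.log n ^ (2 * b + 4 * ε)) →
      -- every weighting giving weight ≥ ⌈n/d⌉ + ⌈n/(d ln^b n)⌉ to the V₀-U edges
      -- makes all weighted degrees in U exceed B₀ + n₀ …
      (∀ ω : Sym2 V → ℕ,
        (∀ u v : V, G.Adj u v → u ∉ U → v ∈ U →
          ⌈(n : ℝ) / (d : ℝ)⌉₊ + ⌈(n : ℝ) / ((d : ℝ) * Real.log n ^ b)⌉₊ ≤ ω s(u, v)) →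
        ∀ u ∈ U,
          ((⌈(n : ℝ) / Real.log n ^ (b + ε)⌉₊ : ℝ) +
              4 * (⌈(n : ℝ) / Real.log n ^ (2 * b + ε)⌉₊ : ℝ) +
              2 * (⌈(n : ℝ) / Real.log n ^ (2 * b + 3 * ε)⌉₊ : ℝ)) + (Uᶜ.card : ℝ) <
            (weightedDeg G ω u : ℝ)) ∧
      -- … in particular B₀ + n₀ < n + 5n/ln^{2b+ε} n
      ((⌈(n : ℝ) / Real.log n ^ (b + ε)⌉₊ : ℝ) +
          4 * (⌈(n : ℝ) / Real.log n ^ (2 * b + ε)⌉₊ : ℝ) +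
          2 * (⌈(n : ℝ) / Real.log n ^ (2 * b + 3 * ε)⌉₊ : ℝ)) + (Uᶜ.card : ℝ) <
        (n : ℝ) + 5 * (n : ℝ) / Real.log n ^ (2 * b + ε) ∧
      -- … < d(1 - 1/ln^{b+ε} n - 1/ln^{2b+4ε} n)(⌈n/d⌉ + ⌈n/(d ln^b n)⌉)
      (n : ℝ) + 5 * (n : ℝ) / Real.log n ^ (2 * b + ε) <
        (d : ℝ) * (1 - 1 / Real.log n ^ (b + ε) - 1 / Real.log n ^ (2 * b + 4 * ε)) *
          ((⌈(n : ℝ) / (d : ℝ)⌉₊ : ℝ) + (⌈(n : ℝ) / ((d : ℝ) * Real.log n ^ b)⌉₊ : ℝ)) := by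
  obtain ⟨N, hN⟩ := eventually_log_natCast_large hε
  refine ⟨N, fun V _ _ G _ n d U hn hG hNn hd₁ hd₂ hU hdeg => ?_⟩
  obtain ⟨hL, hE⟩ := hN n hNn
  have hL0 : 0 < Real.log n := by linarith
  have hX : 1 ≤ Real.log n ^ b := Real.one_le_rpow hL hb.le
  have hd : (1 : ℝ) ≤ d := (Real.one_le_rpow hL (by positivity)).trans hd₁
  have hpow (i j : ℕ) : Real.log n ^ (i * b + j * ε) =
      (Real.log n ^ b) ^ i * (Real.log n ^ ε) ^ j := by
    rw [Real.rpow_add hL0, mul_comm (i : ℝ), mul_comm (j : ℝ), Real.rpow_mul_natCast hL0.le,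
      Real.rpow_mul_natCast hL0.le]
  have e₁ : Real.log n ^ (b + ε) = Real.log n ^ b * Real.log n ^ ε := Real.rpow_add hL0 _ _
  have e₂ : Real.log n ^ (2 * b + ε) = (Real.log n ^ b) ^ 2 * Real.log n ^ ε := by
    simpa using hpow 2 1
  have e₃ : Real.log n ^ (2 * b + 3 * ε) = (Real.log n ^ b) ^ 2 * (Real.log n ^ ε) ^ 3 :=
    mod_cast hpow 2 3
  have e₄ : Real.log n ^ (2 * b + 4 * ε) = (Real.log n ^ b) ^ 2 * (Real.log n ^ ε) ^ 4 :=
    mod_cast hpow 2 4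
  have e₅ : Real.log n ^ (2 * b + 5 * ε) = (Real.log n ^ b) ^ 2 * (Real.log n ^ ε) ^ 5 :=
    mod_cast hpow 2 5
  rw [e₅] at hd₂
  rw [e₁, e₄] at hU
  simp only [e₁, e₄] at hdeg
  rw [e₁, e₂, e₃, e₄]
  generalize Real.log n ^ b = X at *
  generalize Real.log n ^ ε = E at *
  have hX0 : 0 < X := by linarith
  have hE0 : 0 < E := by linarith
  have hn' : X ^ 2 * E ^ 5 ≤ (n : ℝ) := by
    simpa using (le_div_iff₀ (by positivity)).1 (hd.trans hd₂)
  have hn0 : (0 : ℝ) < n := lt_of_lt_of_le (by positivity) hn'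
  have hcompl : (Uᶜ.card : ℝ) = n - U.card := by
    rw [card_compl, Nat.cast_sub (card_le_univ U), hn]
  have hB := ceil_sum_add_lt (m := (Uᶜ.card : ℝ)) hX hE hn'
    (by rw [hcompl]; linarith [(abs_le.1 hU).1])
  have hw := add_lt_mul_ceil_add_ceil hX hE hn0 (show (0 : ℝ) < d by linarith)
  refine ⟨fun ω hω u hu => (hB.trans hw).trans_le ?_, hB, hw⟩
  refine le_trans ?_ (degree_sub_degIn_mul_le_weightedDeg G hG ω hω hu)
  push_cast
  gcongr
  have := (abs_le.1 (hdeg u)).2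
  calc (d : ℝ) * (1 - 1 / (X * E) - 1 / (X ^ 2 * E ^ 4))
      = (d : ℝ) - d / (X * E) - d / (X ^ 2 * E ^ 4) := by ring
    _ ≤ (d : ℝ) - degIn G u U := by linarith
end

section
/- For any positive reals b and ε there exists a constant N such that the following holds for every n ≥ N. Let G be a d-regular simple graph on n vertices with ln^{1+6b+12ε} n ≤ d ≤ n/ln^{2b+5ε} n, let U = U₁ ∪ … ∪ U₇ ⊆ V(G) be a partition satisfying | d_{U_i}(v) − (1/7)·d/ln^{b+ε} n | ≤ (1/7)·d/ln^{2b+4ε} n for all v ∈ V(G) and i ∈ {1,…,7}, and set V₀ = V(G) ∖ U. Let ω be an edge weighting of G such that for every j ∈ {1,…,7} and every edge e joining V₀ and U_j: ⌈n/d⌉ + j·⌈n/(d ln^b n)⌉ ≤ ω(e) ≤ ⌈n/d⌉ + j·⌈n/(d ln^b n)⌉ + ⌈n/(d ln^{b+ε} n)⌉, and such that 0 ≤ ω(e) ≤ ⌈n/d⌉ for every edge e with both ends in U. Then for every i ∈ {1,…,6}, every u ∈ U_i and every v ∈ U_{i+1}: σ_ω(u) < σ_ω(v). -/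
open Finset

open Filter

lemma degIn_biUnion {V ι : Type} [Fintype V] [DecidableEq V] [Fintype ι]
    (G : SimpleGraph V) [DecidableRel G.Adj] (v : V) {U : ι → Finset V}
    (hU : ∀ i j, i ≠ j → Disjoint (U i) (U j)) :
    degIn G v (univ.biUnion U) = ∑ i, degIn G v (U i) := by
  unfold degIn
  rw [inter_biUnion, card_biUnion]
  intro i _ j _ hij
  exact (hU i j hij).mono inter_subset_right inter_subset_right

lemma weightedDeg_le {V : Type} [Fintype V] {G : SimpleGraph V} [DecidableRel G.Adj]
    {ω : Sym2 V → ℕ} {v : V} {M : ℕ} (h : ∀ w, G.Adj v w → ω s(v, w) ≤ M) :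
    weightedDeg G ω v ≤ G.degree v * M :=
  sum_le_card_nsmul _ _ _ fun w hw => h w ((G.mem_neighborFinset v w).1 hw)

/-- If every edge from `v` to the complement of `S` has weight at least `m`, then the weighted
degree of `v` is at least `m` times the number of such edges. -/
lemma degree_mul_le_weightedDeg_add {V : Type} [Fintype V] [DecidableEq V] {G : SimpleGraph V}
    [DecidableRel G.Adj] {ω : Sym2 V → ℕ} {v : V} {S : Finset V} {m : ℕ}
    (h : ∀ w, G.Adj v w → w ∉ S → m ≤ ω s(v, w)) :
    G.degree v * m ≤ weightedDeg G ω v + degIn G v S * m := by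
  have hsum : (G.neighborFinset v \ S).card * m ≤ weightedDeg G ω v := by
    refine (card_nsmul_le_sum (G.neighborFinset v \ S) (fun w => ω s(v, w)) m ?_).trans
      (sum_le_sum_of_subset sdiff_subset)
    intro w hw
    rw [Finset.mem_sdiff, G.mem_neighborFinset] at hw
    exact h w hw.1 hw.2
  have hcard : degIn G v S + (G.neighborFinset v \ S).card = G.degree v :=
    card_inter_add_card_sdiff _ _
  rw [← hcard]
  linarith

/-- In the application `P = ln ^ b n`, `Q = ln ^ ε n`, and `D` is the number of neighbours of a
vertex in `U`. -/
lemma ceil_weight_gap {n d D P Q k : ℝ} (hd : 0 < d) (hP : 1 ≤ P) (hQ : 28 ≤ Q)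
    (hdn : d * (P * Q) ≤ n) (hD : D * (P * Q) ≤ 2 * d) (hD0 : 0 ≤ D) (hk : k ≤ 6) :
    d * (⌈n / d⌉₊ + k * ⌈n / (d * P)⌉₊ + ⌈n / (d * (P * Q))⌉₊) <
      (d - D) * (⌈n / d⌉₊ + (k + 1) * ⌈n / (d * P)⌉₊) := by
  have hPQ : 28 ≤ P * Q := by nlinarith
  have hn : 0 < n := by nlinarith
  have hA : (⌈n / d⌉₊ : ℝ) < n / d + 1 := Nat.ceil_lt_add_one (by positivity)
  have hB : n / (d * P) ≤ (⌈n / (d * P)⌉₊ : ℝ) := Nat.le_ceil _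
  have hC : (⌈n / (d * (P * Q))⌉₊ : ℝ) < n / (d * (P * Q)) + 1 :=
    Nat.ceil_lt_add_one (by positivity)
  have hA0 : (0 : ℝ) ≤ ⌈n / d⌉₊ := Nat.cast_nonneg _
  have hB0 : (0 : ℝ) ≤ ⌈n / (d * P)⌉₊ := Nat.cast_nonneg _
  generalize (⌈n / d⌉₊ : ℝ) = A at *
  generalize (⌈n / (d * P)⌉₊ : ℝ) = B at *
  generalize (⌈n / (d * (P * Q))⌉₊ : ℝ) = C at *
  set R := n / (P * Q) with hR
  have hR0 : 0 < R := by positivity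
  have hdR : d ≤ R := by rw [hR, le_div_iff₀ (by positivity)]; exact hdn
  have hdB : 28 * R ≤ d * B := by
    calc 28 * R ≤ Q * R := by gcongr
      _ = d * (n / (d * P)) := by rw [hR]; field_simp
      _ ≤ d * B := by gcongr
  have hdC : d * C ≤ 2 * R := by
    calc d * C ≤ d * (n / (d * (P * Q)) + 1) := by gcongr
      _ = R + d := by rw [hR]; field_simp
      _ ≤ 2 * R := by linarith
  have hDd : 14 * D ≤ d := by nlinarith
  have hdA : d * A ≤ 2 * n := by
    calc d * A ≤ d * (n / d + 1) := by gcongr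
      _ = n + d := by field_simp
      _ ≤ 2 * n := by nlinarith
  have hDA : D * A ≤ 4 * R := by
    rw [hR, mul_div_assoc', le_div_iff₀ (by positivity)]
    calc D * A * (P * Q) = D * (P * Q) * A := by ring
      _ ≤ 2 * d * A := by gcongr
      _ ≤ 4 * n := by linarith
  have hDB : D * ((k + 1) * B) ≤ d * B / 2 := by
    calc D * ((k + 1) * B) ≤ D * (7 * B) := by gcongr; linarith
      _ = 14 * D * B / 2 := by ring
      _ ≤ d * B / 2 := by gcongr
  linarith

theorem distinction_between_Uis (b ε : ℝ) (hb : 0 < b) (hε : 0 < ε) :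
    ∃ N : ℕ, ∀ (V : Type) [Fintype V] [DecidableEq V] (G : SimpleGraph V)
      [DecidableRel G.Adj] (n d : ℕ) (U : Fin 7 → Finset V) (ω : Sym2 V → ℕ),
      n = Fintype.card V → G.IsRegularOfDegree d → N ≤ n →
      Real.log n ^ (1 + 6 * b + 12 * ε) ≤ (d : ℝ) →
      (d : ℝ) ≤ (n : ℝ) / Real.log n ^ (2 * b + 5 * ε) →
      -- U = U₁ ∪ … ∪ U₇ is a partition
      (∀ i j : Fin 7, i ≠ j → Disjoint (U i) (U j)) →
      -- (2°)
      (∀ v : V, ∀ i : Fin 7,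
        |(degIn G v (U i) : ℝ) - (1 / 7) * ((d : ℝ) / Real.log n ^ (b + ε))| ≤
          (1 / 7) * ((d : ℝ) / Real.log n ^ (2 * b + 4 * ε))) →
      -- weights of the edges joining V₀ = V ∖ U and U_j
      (∀ u v : V, ∀ j : Fin 7, G.Adj u v → u ∉ Finset.univ.biUnion U → v ∈ U j →
        ⌈(n : ℝ) / (d : ℝ)⌉₊ +
            ((j : ℕ) + 1) * ⌈(n : ℝ) / ((d : ℝ) * Real.log n ^ b)⌉₊ ≤ ω s(u, v) ∧
        ω s(u, v) ≤
          ⌈(n : ℝ) / (d : ℝ)⌉₊ +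
            ((j : ℕ) + 1) * ⌈(n : ℝ) / ((d : ℝ) * Real.log n ^ b)⌉₊ +
            ⌈(n : ℝ) / ((d : ℝ) * Real.log n ^ (b + ε))⌉₊) →
      -- weights of the edges inside U
      (∀ u v : V, G.Adj u v → u ∈ Finset.univ.biUnion U → v ∈ Finset.univ.biUnion U →
        ω s(u, v) ≤ ⌈(n : ℝ) / (d : ℝ)⌉₊) →
      -- conclusion: weighted degrees increase from U_i to U_{i+1}
      ∀ i : Fin 6, ∀ u ∈ U i.castSucc, ∀ v ∈ U i.succ,
        weightedDeg G ω u < weightedDeg G ω v := by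
  have hlog : Tendsto (fun n : ℕ => Real.log n) atTop atTop :=
    Real.tendsto_log_atTop.comp tendsto_natCast_atTop_atTop
  obtain ⟨N, hN⟩ := eventually_atTop.1 ((hlog.eventually_ge_atTop 1).and
    (((tendsto_rpow_atTop hε).comp hlog).eventually_ge_atTop 28))
  refine ⟨N, ?_⟩
  intro V _ _ G _ n d U ω _ hreg hNn hd hdn hdisj hdeg hcross hin i u hu v hv
  obtain ⟨hL, hQ⟩ := hN n hNn
  simp only [Function.comp_apply] at hQ
  have hL0 : 0 < Real.log n := by linarith
  have hPQ : Real.log n ^ (b + ε) = Real.log n ^ b * Real.log n ^ ε := Real.rpow_add hL0 _ _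
  have hd0 : (0 : ℝ) < d := (Real.rpow_pos_of_pos hL0 _).trans_le hd
  have hPQ0 : 0 < Real.log n ^ (b + ε) := Real.rpow_pos_of_pos hL0 _
  have hdPQ : (d : ℝ) * Real.log n ^ (b + ε) ≤ n := by
    rw [le_div_iff₀ (Real.rpow_pos_of_pos hL0 _)] at hdn
    refine le_trans ?_ hdn
    exact mul_le_mul_of_nonneg_left (Real.rpow_le_rpow_of_exponent_le hL (by linarith)) hd0.le
  have hD : (degIn G v (univ.biUnion U) : ℝ) * Real.log n ^ (b + ε) ≤ 2 * d := by
    rw [← le_div_iff₀ hPQ0, degIn_biUnion G v hdisj, Nat.cast_sum]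
    have hle : ∀ j ∈ (univ : Finset (Fin 7)),
        (degIn G v (U j) : ℝ) ≤ 2 / 7 * (d / Real.log n ^ (b + ε)) := by
      intro j _
      have herr : (d : ℝ) / Real.log n ^ (2 * b + 4 * ε) ≤ d / Real.log n ^ (b + ε) :=
        div_le_div_of_nonneg_left hd0.le hPQ0
          (Real.rpow_le_rpow_of_exponent_le hL (by linarith))
      linarith [(abs_le.1 (hdeg v j)).2]
    refine (sum_le_card_nsmul _ _ _ hle).trans_eq ?_
    simp only [card_univ, Fintype.card_fin, nsmul_eq_mul]
    push_cast
    ring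
  have hupper := weightedDeg_le (G := G) (ω := ω) (v := u)
    (M := ⌈(n : ℝ) / d⌉₊ + ((i : ℕ) + 1) * ⌈(n : ℝ) / (d * Real.log n ^ b)⌉₊ +
      ⌈(n : ℝ) / (d * Real.log n ^ (b + ε))⌉₊) (by
    intro w hw
    by_cases hwU : w ∈ univ.biUnion U
    · have huU : u ∈ univ.biUnion U := mem_biUnion.2 ⟨_, mem_univ _, hu⟩
      have := hin u w hw huU hwU
      rw [add_assoc]
      exact this.trans (Nat.le_add_right _ _)
    · rw [Sym2.eq_swap]
      exact (hcross w u _ hw.symm hwU hu).2)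
  have hlower := degree_mul_le_weightedDeg_add (G := G) (ω := ω) (v := v)
    (S := univ.biUnion U)
    (m := ⌈(n : ℝ) / d⌉₊ + ((i : ℕ) + 1 + 1) * ⌈(n : ℝ) / (d * Real.log n ^ b)⌉₊) (by
    intro w hw hwU
    rw [Sym2.eq_swap]
    exact (hcross w v _ hw.symm hwU hv).1)
  rw [hreg.degree_eq] at hupper hlower
  have hi : ((i : ℕ) : ℝ) + 1 ≤ 6 := by exact_mod_cast i.isLt
  rw [hPQ] at hdPQ hD hupper
  have hgap := ceil_weight_gap hd0 (Real.one_le_rpow hL hb.le) hQ hdPQ hD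
    (Nat.cast_nonneg _) hi
  have hupper' := (Nat.cast_le (α := ℝ)).2 hupper
  have hlower' := (Nat.cast_le (α := ℝ)).2 hlower
  push_cast at hupper' hlower'
  have hlt : (weightedDeg G ω u : ℝ) < weightedDeg G ω v := by linarith
  exact_mod_cast hlt
end
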